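/- arXiv:1210.6056 — 6 statements merged into one kernel-verified Lean document; each statement's English description precedes it below -/
import Mathlib

section
/- For every n ≥ 2, the number of arc permutations in S_n equals n·2^{n−2}. -/
/-- The set of the first `j+1` letters (0-indexed prefix) of the permutation `π`. -/
def prefSet {n : ℕ} (π : Equiv.Perm (Fin n)) (j : Fin n) : Finset (Fin n) :=
  (Finset.Iic j).image π

/-- A finset of `Fin n` is a cyclic interval in `ℤ_n`: its elements are
consecutive modulo `n`. -/
def IsCyclicIntervalFinset {n : ℕ} (S : Finset (Fin n)) : Prop :=
  ∃ a k : ℕ, ∀ x : Fin n, x ∈ S ↔ ∃ i < k, ((x : ℕ) : ZMod n) = (a : ZMod n) + (i : ZMod n)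

/-- A permutation is an arc permutation if every prefix set is a cyclic
interval in `ℤ_n`. -/
def IsArc {n : ℕ} (π : Equiv.Perm (Fin n)) : Prop :=
  ∀ j : Fin n, IsCyclicIntervalFinset (prefSet π j)

/-- The cyclic interval `{a, a + 1, …, a + (k - 1)}` of `ZMod N`. -/
def arcSet {N : ℕ} (a : ZMod N) (k : ℕ) : Set (ZMod N) :=
  {x | ∃ i < k, x = a + (i : ZMod N)}

theorem arcSet_one {N : ℕ} (a : ZMod N) : arcSet a 1 = {a} := by
  ext x
  simp [arcSet]

theorem arcSet_succ {N : ℕ} (a : ZMod N) (k : ℕ) :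
    arcSet a (k + 1) = insert (a + (k : ZMod N)) (arcSet a k) := by
  ext x
  simp only [arcSet, Set.mem_insert_iff, Set.mem_ofPred_eq]
  constructor
  · rintro ⟨i, hi, rfl⟩
    rcases Nat.lt_succ_iff_lt_or_eq.mp hi with h | rfl
    · exact Or.inr ⟨i, h, rfl⟩
    · exact Or.inl rfl
  · rintro (rfl | ⟨i, hi, rfl⟩)
    · exact ⟨k, by omega, rfl⟩
    · exact ⟨i, by omega, rfl⟩

theorem arcSet_sub_one_succ {N : ℕ} (a : ZMod N) (k : ℕ) :
    arcSet (a - 1) (k + 1) = insert (a - 1) (arcSet a k) := by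
  ext x
  simp only [arcSet, Set.mem_insert_iff, Set.mem_ofPred_eq]
  constructor
  · rintro ⟨i, hi, rfl⟩
    rcases i with _ | i
    · left; simp
    · right; exact ⟨i, by omega, by push_cast; ring⟩
  · rintro (rfl | ⟨i, hi, rfl⟩)
    · exact ⟨0, by omega, by simp⟩
    · exact ⟨i + 1, by omega, by push_cast; ring⟩

theorem add_notMem_arcSet {N : ℕ} (a : ZMod N) {k : ℕ} (hk : k < N) :
    a + (k : ZMod N) ∉ arcSet a k := by
  rintro ⟨i, hi, h⟩
  have h' := (ZMod.natCast_eq_natCast_iff' _ _ _).mp (add_left_cancel h)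
  rw [Nat.mod_eq_of_lt hk, Nat.mod_eq_of_lt (hi.trans hk)] at h'
  omega

theorem sub_one_notMem_arcSet {N : ℕ} (a : ZMod N) {k : ℕ} (hk : k < N) :
    a - 1 ∉ arcSet a k := by
  rintro ⟨i, hi, h⟩
  have h' : ((i + 1 : ℕ) : ZMod N) = 0 := by
    push_cast
    linear_combination -h
  have := Nat.le_of_dvd (by omega) ((ZMod.natCast_eq_zero_iff _ _).mp h')
  omega

theorem eq_of_mem_arcSet_of_sub_one_notMem {N : ℕ} {b x : ZMod N} {k : ℕ}
    (hx : x ∈ arcSet b k) (hx' : x - 1 ∉ arcSet b k) : x = b := by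
  obtain ⟨i, hi, rfl⟩ := hx
  rcases i with _ | i
  · simp
  · exact absurd ⟨i, by omega, by push_cast; ring⟩ hx'

/-- A cyclic interval can only be enlarged by one element at one of its two ends. -/
theorem eq_or_eq_of_insert_arcSet {N : ℕ} {a b e : ZMod N} {k l : ℕ} (hk : 0 < k) (hkN : k < N)
    (he : e ∉ arcSet a k) (h : insert e (arcSet a k) = arcSet b l) :
    e = a + (k : ZMod N) ∨ e = a - 1 := by
  by_contra! hne
  have ha : a ∈ arcSet b l := h ▸ Set.mem_insert_of_mem _ ⟨0, hk, by simp⟩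
  have ha' : a - 1 ∉ arcSet b l := by
    rw [← h]
    rintro (h1 | h1)
    · exact hne.2 h1.symm
    · exact sub_one_notMem_arcSet a hkN h1
  obtain rfl := eq_of_mem_arcSet_of_sub_one_notMem ha ha'
  obtain ⟨t, ht, rfl⟩ : e ∈ arcSet a l := h ▸ Set.mem_insert _ _
  have hkt : k ≤ t := by
    by_contra! h1
    exact he ⟨t, h1, rfl⟩
  have hmem : a + (k : ZMod N) ∈ arcSet a l := ⟨k, by omega, rfl⟩
  rw [← h] at hmem
  rcases hmem with h1 | h1
  · exact hne.1 h1.symm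
  · exact add_notMem_arcSet a hkN h1

/-- The left end of the arc obtained from `{c}` by adding the right neighbour at step `j` if
`w j`, and the left neighbour otherwise. -/
def leftEnd {N : ℕ} (c : ZMod N) (w : ℕ → Bool) : ℕ → ZMod N
  | 0 => c
  | j + 1 => if w j then leftEnd c w j else leftEnd c w j - 1

/-- The sequence of elements added to the growing arc described by `w`. -/
def arcSeq {N : ℕ} (c : ZMod N) (w : ℕ → Bool) : ℕ → ZMod N
  | 0 => c
  | j + 1 => if w j then leftEnd c w j + ((j + 1 : ℕ) : ZMod N) else leftEnd c w j - 1

theorem image_Iic_succ {α : Type*} (g : ℕ → α) (j : ℕ) :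
    g '' Set.Iic (j + 1) = insert (g (j + 1)) (g '' Set.Iic j) := by
  rw [← Set.image_insert_eq]
  congr 1
  ext x
  simp only [Set.mem_Iic, Set.mem_insert_iff]
  omega

theorem arcSeq_image_Iic {N : ℕ} (c : ZMod N) (w : ℕ → Bool) (j : ℕ) :
    arcSeq c w '' Set.Iic j = arcSet (leftEnd c w j) (j + 1) := by
  induction j with
  | zero =>
    have : Set.Iic (0 : ℕ) = {0} := by ext; simp
    simp [this, arcSet_one, arcSeq, leftEnd]
  | succ j ih =>
    rw [image_Iic_succ, ih]
    simp only [arcSeq, leftEnd]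
    split_ifs
    · rw [arcSet_succ _ (j + 1)]
    · rw [arcSet_sub_one_succ]

theorem arcSeq_succ_notMem {N : ℕ} (c : ZMod N) (w : ℕ → Bool) {j : ℕ} (hj : j + 1 < N) :
    arcSeq c w (j + 1) ∉ arcSeq c w '' Set.Iic j := by
  rw [arcSeq_image_Iic]
  simp only [arcSeq]
  split_ifs
  · exact add_notMem_arcSet _ hj
  · exact sub_one_notMem_arcSet _ hj

theorem arcSeq_ne {N : ℕ} (c : ZMod N) (w : ℕ → Bool) {i j : ℕ} (hij : i < j) (hj : j < N) :
    arcSeq c w i ≠ arcSeq c w j := by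
  obtain ⟨j, rfl⟩ : ∃ t, j = t + 1 := ⟨j - 1, by omega⟩
  intro h
  exact arcSeq_succ_notMem c w hj ⟨i, Nat.lt_succ_iff.mp hij, h⟩

/-- The permutation of `Fin (m + 2)` with one-line notation `arcSeq c w`. -/
noncomputable def arcPerm {m : ℕ} (c : ZMod (m + 2)) (w : ℕ → Bool) :
    Equiv.Perm (Fin (m + 2)) :=
  Equiv.ofBijective (fun j : Fin (m + 2) => (arcSeq c w j : ZMod (m + 2)))
    (Finite.injective_iff_bijective.mp fun i j h => by
      rcases lt_trichotomy i j with hij | hij | hij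
      · exact absurd h (arcSeq_ne c w hij j.2)
      · exact hij
      · exact absurd h.symm (arcSeq_ne c w hij i.2))

theorem natCast_val_eq {m : ℕ} (x : Fin (m + 2)) :
    ((x : ℕ) : ZMod (m + 2)) = (x : ZMod (m + 2)) :=
  ZMod.natCast_zmod_val (n := m + 2) x

/-- The one-line notation of a permutation as a sequence in `ZMod (m + 2)`. -/
def oneLine {m : ℕ} (π : Equiv.Perm (Fin (m + 2))) (j : ℕ) : ZMod (m + 2) :=
  π (Fin.ofNat (m + 2) j)

theorem oneLine_val {m : ℕ} (π : Equiv.Perm (Fin (m + 2))) (j : Fin (m + 2)) :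
    oneLine π j = π j := by
  exact congrArg π (Fin.ext (Nat.mod_eq_of_lt j.2))

theorem oneLine_arcPerm {m : ℕ} (c : ZMod (m + 2)) (w : ℕ → Bool) {j : ℕ} (hj : j < m + 2) :
    oneLine (arcPerm c w) j = arcSeq c w j :=
  oneLine_val (arcPerm c w) ⟨j, hj⟩

theorem oneLine_ne {m : ℕ} (π : Equiv.Perm (Fin (m + 2))) {i j : ℕ} (hij : i < j)
    (hj : j < m + 2) : oneLine π i ≠ oneLine π j := by
  intro h
  have h1 : (⟨i, hij.trans hj⟩ : Fin (m + 2)) = ⟨j, hj⟩ :=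
    π.injective ((oneLine_val π ⟨i, hij.trans hj⟩).symm.trans (h.trans (oneLine_val π ⟨j, hj⟩)))
  simp only [Fin.mk.injEq] at h1
  omega

theorem mem_prefSet_iff {m : ℕ} (π : Equiv.Perm (Fin (m + 2))) (j x : Fin (m + 2)) :
    x ∈ prefSet π j ↔ ((x : ℕ) : ZMod (m + 2)) ∈ oneLine π '' Set.Iic (j : ℕ) := by
  rw [natCast_val_eq]
  simp only [prefSet, Finset.mem_image, Finset.mem_Iic]
  constructor
  · rintro ⟨i, hi, rfl⟩
    exact ⟨i, hi, oneLine_val π i⟩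
  · rintro ⟨i, hi, h⟩
    have hi' : i < m + 2 := lt_of_le_of_lt hi j.2
    exact ⟨⟨i, hi'⟩, hi, (oneLine_val π ⟨i, hi'⟩).symm.trans h⟩

theorem isCyclicIntervalFinset_prefSet_iff {m : ℕ} (π : Equiv.Perm (Fin (m + 2)))
    (j : Fin (m + 2)) : IsCyclicIntervalFinset (prefSet π j) ↔
      ∃ (a : ZMod (m + 2)) (k : ℕ), oneLine π '' Set.Iic (j : ℕ) = arcSet a k := by
  constructor
  · rintro ⟨a, k, h⟩
    refine ⟨a, k, ?_⟩
    ext x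
    have hx : ((ZMod.val x : ℕ) : ZMod (m + 2)) ∈ oneLine π '' Set.Iic (j : ℕ) ↔
        ((ZMod.val x : ℕ) : ZMod (m + 2)) ∈ arcSet (a : ZMod (m + 2)) k :=
      (mem_prefSet_iff π j x).symm.trans (h x)
    rwa [ZMod.natCast_zmod_val] at hx
  · rintro ⟨a, k, h⟩
    refine ⟨a.val, k, fun x => ?_⟩
    rw [mem_prefSet_iff, h, ZMod.natCast_zmod_val]
    rfl

theorem isArc_arcPerm {m : ℕ} (c : ZMod (m + 2)) (w : ℕ → Bool) : IsArc (arcPerm c w) := by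
  intro j
  rw [isCyclicIntervalFinset_prefSet_iff]
  refine ⟨_, _, Eq.trans (Set.image_congr fun i hi => ?_) (arcSeq_image_Iic c w j)⟩
  exact oneLine_arcPerm c w (lt_of_le_of_lt hi j.2)

/-- Extend a finite word by `false`. -/
def extendWord {m : ℕ} (w : Fin m → Bool) (j : ℕ) : Bool :=
  if h : j < m then w ⟨j, h⟩ else false

theorem leftEnd_congr {N : ℕ} (c : ZMod N) {w v : ℕ → Bool} {j : ℕ}
    (h : ∀ i < j, w i = v i) : leftEnd c w j = leftEnd c v j := by
  induction j with
  | zero => rfl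
  | succ j ih => simp only [leftEnd, h j (by omega), ih fun i hi => h i (by omega)]

theorem arcSeq_word_injective {m : ℕ} {c d : ZMod (m + 2)} {w v : Fin m → Bool}
    (h : ∀ j < m + 2, arcSeq c (extendWord w) j = arcSeq d (extendWord v) j) :
    c = d ∧ w = v := by
  obtain rfl : c = d := h 0 (by omega)
  refine ⟨rfl, ?_⟩
  have key : ∀ j < m, extendWord w j = extendWord v j := by
    intro j
    induction j using Nat.strong_induction_on with
    | _ j ih =>
      intro hj
      have hl := leftEnd_congr c fun i hi => ih i hi (hi.trans hj)
      have hs := h (j + 1) (by omega)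
      have hne : leftEnd c (extendWord v) j - 1 ≠
          leftEnd c (extendWord v) j + ((j + 1 : ℕ) : ZMod (m + 2)) := fun h1 =>
        sub_one_notMem_arcSet (k := j + 2) _ (by omega) ⟨j + 1, by omega, h1⟩
      simp only [arcSeq, hl] at hs
      cases hw : extendWord w j <;> cases hv : extendWord v j <;> simp only [hw, hv] at hs ⊢
      · exact absurd hs hne
      · exact absurd hs.symm hne
  funext j
  simpa [extendWord] using key j j.2

/-- The left ends of the prefixes of a sequence, provided these are arcs. -/
def prefixLeftEnd {N : ℕ} (g : ℕ → ZMod N) : ℕ → ZMod N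
  | 0 => g 0
  | j + 1 => if g (j + 1) = prefixLeftEnd g j - 1 then prefixLeftEnd g j - 1
      else prefixLeftEnd g j

theorem exists_arcSeq_eq {m : ℕ} (g : ℕ → ZMod (m + 2))
    (hinj : ∀ i j, i < j → j < m + 2 → g i ≠ g j)
    (harc : ∀ j < m + 2, ∃ (a : ZMod (m + 2)) (k : ℕ), g '' Set.Iic j = arcSet a k) :
    ∃ w : Fin m → Bool, ∀ j < m + 2, arcSeq (g 0) (extendWord w) j = g j := by
  set w : Fin m → Bool := fun j => decide (g (j + 1) ≠ prefixLeftEnd g j - 1) with hw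
  have hext : ∀ j < m, extendWord w j = decide (g (j + 1) ≠ prefixLeftEnd g j - 1) := by
    intro j hj
    simp [extendWord, hj, hw]
  have hleft : ∀ j ≤ m, leftEnd (g 0) (extendWord w) j = prefixLeftEnd g j := by
    intro j
    induction j with
    | zero => intro _; rfl
    | succ j ih =>
      intro hj
      simp only [leftEnd, prefixLeftEnd, ih (by omega), hext j (by omega)]
      by_cases h : g (j + 1) = prefixLeftEnd g j - 1 <;> simp [h]
  refine ⟨w, fun j => ?_⟩
  induction j using Nat.strong_induction_on with
  | _ j ih =>
    intro hj
    rcases j with _ | j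
    · rfl
    have himg : g '' Set.Iic j = arcSet (prefixLeftEnd g j) (j + 1) := by
      rw [← hleft j (by omega), ← arcSeq_image_Iic]
      exact Set.image_congr fun i hi =>
        (ih i (Nat.lt_succ_of_le hi) (lt_of_le_of_lt hi (by omega))).symm
    have hnot : g (j + 1) ∉ arcSet (prefixLeftEnd g j) (j + 1) := by
      rw [← himg]
      rintro ⟨i, hi, h⟩
      exact hinj i (j + 1) (Nat.lt_succ_of_le hi) hj h
    obtain ⟨a, k, hak⟩ := harc (j + 1) hj
    rw [image_Iic_succ, himg] at hak
    have hor := eq_or_eq_of_insert_arcSet (by omega) hj hnot hak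
    simp only [arcSeq, hleft j (by omega)]
    rcases Nat.lt_or_ge j m with hjm | hjm
    · rw [hext j hjm]
      by_cases h : g (j + 1) = prefixLeftEnd g j - 1
      · simp [h]
      · simpa [h] using (hor.resolve_right h).symm
    · obtain rfl : j = m := by omega
      have hzero : ((j + 2 : ℕ) : ZMod (j + 2)) = 0 := ZMod.natCast_self _
      have hsame : prefixLeftEnd g j + ((j + 1 : ℕ) : ZMod (j + 2)) = prefixLeftEnd g j - 1 := by
        push_cast at hzero ⊢
        linear_combination hzero
      rw [hsame, or_self] at hor
      simp [extendWord, hor]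

/-- The arc permutation with a given first letter and word of left and right choices. -/
noncomputable def wordToArc {m : ℕ} (p : ZMod (m + 2) × (Fin m → Bool)) :
    {π : Equiv.Perm (Fin (m + 2)) // IsArc π} :=
  ⟨arcPerm p.1 (extendWord p.2), isArc_arcPerm _ _⟩

theorem wordToArc_bijective (m : ℕ) : Function.Bijective (wordToArc (m := m)) := by
  constructor
  · rintro ⟨c, w⟩ ⟨d, v⟩ h
    have hp : arcPerm c (extendWord w) = arcPerm d (extendWord v) := congrArg Subtype.val h
    obtain ⟨rfl, rfl⟩ := arcSeq_word_injective (c := c) (d := d) (w := w) (v := v) fun j hj => by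
      rw [← oneLine_arcPerm _ _ hj, hp, oneLine_arcPerm _ _ hj]
    rfl
  · rintro ⟨π, hπ⟩
    obtain ⟨w, hw⟩ := exists_arcSeq_eq (oneLine π) (fun i j => oneLine_ne π)
      fun j hj => (isCyclicIntervalFinset_prefSet_iff π ⟨j, hj⟩).mp (hπ ⟨j, hj⟩)
    refine ⟨(oneLine π 0, w), Subtype.ext (Equiv.ext fun j => ?_)⟩
    exact (hw j j.2).trans (oneLine_val π j)

/-- The number of arc permutations in `S_n` is `n·2^(n-2)` for `n ≥ 2`. -/
theorem stmt2 (n : ℕ) (hn : 2 ≤ n) :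
    Nat.card {π : Equiv.Perm (Fin n) // IsArc π} = n * 2 ^ (n - 2) := by
  obtain ⟨m, rfl⟩ : ∃ m, n = m + 2 := ⟨n - 2, by omega⟩
  rw [← Nat.card_congr (Equiv.ofBijective _ (wordToArc_bijective m)), Nat.card_prod,
    Nat.card_zmod]
  simp
end

section
/- For every n ≥ 1, a permutation in S_n is an arc permutation if and only if it avoids all eight patterns 1324, 1342, 2413, 2431, 3124, 3142, 4213, 4231 (the eight patterns τ ∈ S_4 with |τ(1) − τ(2)| = 2); that is, A_n = S_n(1324, 1342, 2413, 2431, 3124, 3142, 4213, 4231). -/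
/-- `π` contains the pattern `τ`. -/
def Contains {n k : ℕ} (π : Equiv.Perm (Fin n)) (τ : Equiv.Perm (Fin k)) : Prop :=
  ∃ f : Fin k → Fin n, StrictMono f ∧ ∀ a b : Fin k, π (f a) < π (f b) ↔ τ a < τ b

/-- `π` avoids the pattern `τ`. -/
def Avoids {n k : ℕ} (π : Equiv.Perm (Fin n)) (τ : Equiv.Perm (Fin k)) : Prop :=
  ¬ Contains π τ

/-- Build a permutation from a bijective function. -/
noncomputable def mkPerm {k : ℕ} (f : Fin k → Fin k) (h : Function.Bijective f) :
    Equiv.Perm (Fin k) :=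
  Equiv.ofBijective f h

/-- The pattern 1324. -/
noncomputable def p1324 : Equiv.Perm (Fin 4) := mkPerm ![0, 2, 1, 3] (by decide)
/-- The pattern 1342. -/
noncomputable def p1342 : Equiv.Perm (Fin 4) := mkPerm ![0, 2, 3, 1] (by decide)
/-- The pattern 2413. -/
noncomputable def p2413 : Equiv.Perm (Fin 4) := mkPerm ![1, 3, 0, 2] (by decide)
/-- The pattern 2431. -/
noncomputable def p2431 : Equiv.Perm (Fin 4) := mkPerm ![1, 3, 2, 0] (by decide)
/-- The pattern 3124. -/
noncomputable def p3124 : Equiv.Perm (Fin 4) := mkPerm ![2, 0, 1, 3] (by decide)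
/-- The pattern 3142. -/
noncomputable def p3142 : Equiv.Perm (Fin 4) := mkPerm ![2, 0, 3, 1] (by decide)
/-- The pattern 4213. -/
noncomputable def p4213 : Equiv.Perm (Fin 4) := mkPerm ![3, 1, 0, 2] (by decide)
/-- The pattern 4231. -/
noncomputable def p4231 : Equiv.Perm (Fin 4) := mkPerm ![3, 1, 2, 0] (by decide)
/-- The pattern 2143. -/
noncomputable def p2143 : Equiv.Perm (Fin 4) := mkPerm ![1, 0, 3, 2] (by decide)
/-- The pattern 3412. -/
noncomputable def p3412 : Equiv.Perm (Fin 4) := mkPerm ![2, 3, 0, 1] (by decide)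

/-- The pairs `{p, q}` and `{r, s}` separate each other on the cycle. -/
def Interleaves {n : ℕ} (p q r s : Fin n) : Prop :=
  (p < r ∧ r < q ∧ q < s) ∨ (p < s ∧ s < q ∧ q < r) ∨
  (r < p ∧ p < s ∧ s < q) ∨ (s < p ∧ p < r ∧ r < q) ∨
  (q < r ∧ r < p ∧ p < s) ∨ (q < s ∧ s < p ∧ p < r) ∨
  (r < q ∧ q < s ∧ s < p) ∨ (s < q ∧ q < r ∧ r < p)

theorem Interleaves.swap_left {n : ℕ} {p q r s : Fin n} (h : Interleaves p q r s) :
    Interleaves q p r s := by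
  unfold Interleaves at *
  rcases h with h | h | h | h | h | h | h | h <;> simp [h]

theorem Interleaves.swap_right {n : ℕ} {p q r s : Fin n} (h : Interleaves p q r s) :
    Interleaves p q s r := by
  unfold Interleaves at *
  rcases h with h | h | h | h | h | h | h | h <;> simp [h]

theorem exists_natCast_eq_add_iff {n : ℕ} {a : ℕ} (ha : a ≤ n) (k : ℕ) (x : Fin n) :
    (∃ i < k, ((x : ℕ) : ZMod n) = (a : ZMod n) + (i : ZMod n)) ↔
      (a ≤ x ∧ (x : ℕ) < a + k) ∨ (x : ℕ) + n < a + k := by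
  have hx := x.isLt
  constructor
  · rintro ⟨i, hi, h⟩
    rw [← Nat.cast_add, ZMod.natCast_eq_natCast_iff'] at h
    rw [Nat.mod_eq_of_lt hx] at h
    have hdiv := Nat.mod_add_div (a + i) n
    rcases Nat.eq_zero_or_pos ((a + i) / n) with h0 | h0
    · rw [h0] at hdiv
      omega
    · have := Nat.le_mul_of_pos_right n h0
      omega
  · rintro (⟨h1, h2⟩ | h)
    · refine ⟨x - a, by omega, ?_⟩
      rw [← Nat.cast_add, Nat.add_sub_cancel' h1]
    · refine ⟨x + n - a, by omega, ?_⟩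
      rw [← Nat.cast_add, Nat.add_sub_cancel' (by omega)]
      simp

theorem IsCyclicIntervalFinset.not_interleaves {n : ℕ} {S : Finset (Fin n)}
    (hS : IsCyclicIntervalFinset S) {p q r s : Fin n} (hp : p ∈ S) (hq : q ∈ S)
    (hr : r ∉ S) (hs : s ∉ S) : ¬ Interleaves p q r s := by
  obtain ⟨a, k, h⟩ := hS
  have hn : 0 < n := p.pos
  have key : ∀ x : Fin n, x ∈ S ↔
      (a % n ≤ x ∧ (x : ℕ) < a % n + k) ∨ (x : ℕ) + n < a % n + k := by
    intro x
    rw [h, ← exists_natCast_eq_add_iff (Nat.mod_lt a hn).le, ZMod.natCast_mod]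
  rw [key] at hp hq hr hs
  unfold Interleaves
  simp only [Fin.lt_def]
  omega

theorem isCyclicIntervalFinset_of_not_interleaves {n : ℕ} {S : Finset (Fin n)}
    (h : ∀ p ∈ S, ∀ q ∈ S, ∀ r ∉ S, ∀ s ∉ S, ¬ Interleaves p q r s) :
    IsCyclicIntervalFinset S := by
  suffices ∃ a ≤ n, ∃ k, ∀ x : Fin n, x ∈ S ↔
      (a ≤ x ∧ (x : ℕ) < a + k) ∨ (x : ℕ) + n < a + k by
    obtain ⟨a, ha, k, hk⟩ := this
    exact ⟨a, k, fun x => (hk x).trans (exists_natCast_eq_add_iff ha k x).symm⟩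
  rcases S.eq_empty_or_nonempty with rfl | hne
  · exact ⟨0, n.zero_le, 0, fun x => by simp⟩
  rcases Sᶜ.eq_empty_or_nonempty with hc | hcne
  · rw [Finset.compl_eq_empty_iff] at hc
    exact ⟨0, n.zero_le, n, fun x => by simp [hc]⟩
  let o : Fin n := ⟨0, hne.choose.pos⟩
  by_cases ho : o ∈ S
  · have hl := Finset.min'_mem _ hcne
    obtain ⟨l, hl, hle⟩ := Sᶜ.exists_min_image id hcne
    obtain ⟨r, hr, hge⟩ := Sᶜ.exists_max_image id hcne
    simp only [Finset.mem_compl, id] at hl hr hle hge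
    have hlr := hle r hr
    refine ⟨r + 1, r.isLt, n - 1 - r + l, fun x => ⟨fun hx => ?_, fun hx => ?_⟩⟩
    · have := h o ho x hx l hl r hr
      have hol : o ≠ l := fun e => hl (e ▸ ho)
      have hxl : x ≠ l := fun e => hl (e ▸ hx)
      have hxr : x ≠ r := fun e => hr (e ▸ hx)
      unfold Interleaves at this
      simp only [Fin.lt_def, Fin.le_def, ne_eq, Fin.ext_iff, o] at *
      omega
    · by_contra hxS
      have h1 := hle x hxS
      have h2 := hge x hxS
      simp only [Fin.le_def] at *
      omega
  · have hl := Finset.min'_mem _ hne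
    obtain ⟨l, hl, hle⟩ := S.exists_min_image id hne
    obtain ⟨r, hr, hge⟩ := S.exists_max_image id hne
    simp only [id] at hle hge
    have hlr := hle r hr
    refine ⟨l, l.isLt.le, r - l + 1, fun x => ⟨fun hx => ?_, fun hx => ?_⟩⟩
    · have h1 := hle x hx
      have h2 := hge x hx
      simp only [Fin.le_def] at *
      omega
    · by_contra hxS
      have := h l hl r hr o ho x hxS
      have hol : o ≠ l := fun e => ho (e ▸ hl)
      have hxl : x ≠ l := fun e => hxS (e ▸ hl)
      have hxr : x ≠ r := fun e => hxS (e ▸ hr)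
      unfold Interleaves at this
      simp only [Fin.lt_def, Fin.le_def, ne_eq, Fin.ext_iff, o] at *
      omega

theorem apply_mem_prefSet {n : ℕ} (π : Equiv.Perm (Fin n)) (i j : Fin n) :
    π i ∈ prefSet π j ↔ i ≤ j := by
  simp [prefSet]

theorem isArc_iff_not_interleaves {n : ℕ} (π : Equiv.Perm (Fin n)) :
    IsArc π ↔ ∀ w x y z : Fin n, w < x → x < y → y < z →
      ¬ Interleaves (π w) (π x) (π y) (π z) := by
  constructor
  · intro h w x y z hwx hxy hyz
    apply (h x).not_interleaves <;> rw [apply_mem_prefSet]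
    exacts [hwx.le, hxy.not_ge, (hxy.trans hyz).not_ge]
  · intro h j
    apply isCyclicIntervalFinset_of_not_interleaves
    intro p hp q hq r hr s hs hI
    obtain ⟨w, rfl⟩ := π.surjective p
    obtain ⟨x, rfl⟩ := π.surjective q
    obtain ⟨y, rfl⟩ := π.surjective r
    obtain ⟨z, rfl⟩ := π.surjective s
    rw [apply_mem_prefSet] at hp hq hr hs
    rw [not_le] at hr hs
    rcases lt_trichotomy w x with hwx | rfl | hwx <;>
      rcases lt_trichotomy y z with hyz | rfl | hyz
    · exact h w x y z hwx (hq.trans_lt hr) hyz hI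
    · simp only [Interleaves, Fin.lt_def] at hI; omega
    · exact h w x z y hwx (hq.trans_lt hs) hyz hI.swap_right
    · simp only [Interleaves, Fin.lt_def] at hI; omega
    · simp only [Interleaves, Fin.lt_def] at hI; omega
    · simp only [Interleaves, Fin.lt_def] at hI; omega
    · exact h x w y z hwx (hp.trans_lt hr) hyz hI.swap_left
    · simp only [Interleaves, Fin.lt_def] at hI; omega
    · exact h x w z y hwx (hp.trans_lt hs) hyz hI.swap_left.swap_right

/-- Containment of a pattern of length four, with the positions `a, b, c, d` of the pattern's
letters listed in increasing order of the letters. -/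
theorem avoids_four_iff {n : ℕ} (π : Equiv.Perm (Fin n)) {τ : Equiv.Perm (Fin 4)}
    {a b c d : Fin 4} (ha : τ a = 0) (hb : τ b = 1) (hc : τ c = 2) (hd : τ d = 3) :
    Avoids π τ ↔ ∀ w x y z : Fin n, w < x → x < y → y < z →
      ¬ (π (![w, x, y, z] a) < π (![w, x, y, z] b) ∧
         π (![w, x, y, z] b) < π (![w, x, y, z] c) ∧
         π (![w, x, y, z] c) < π (![w, x, y, z] d)) := by
  constructor
  · rintro h w x y z hwx hxy hyz ⟨h1, h2, h3⟩
    refine h ⟨![w, x, y, z], ?_, ?_⟩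
    · simp [Fin.strictMono_iff_lt_succ, Fin.forall_fin_succ, hwx, hxy, hyz]
    · have hmono : StrictMono fun i => π (![w, x, y, z] (τ.symm i)) := by
        rw [← Equiv.eq_symm_apply] at ha hb hc hd
        subst ha hb hc hd
        rw [Fin.strictMono_iff_lt_succ]
        intro i
        fin_cases i <;> assumption
      intro i j
      simpa using hmono.lt_iff_lt (a := τ i) (b := τ j)
  · rintro h ⟨f, hf, hfπ⟩
    have hvec : ![f 0, f 1, f 2, f 3] = f := by
      ext i
      fin_cases i <;> rfl
    refine h (f 0) (f 1) (f 2) (f 3) (hf (by decide)) (hf (by decide)) (hf (by decide)) ?_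
    rw [hvec, hfπ, hfπ, hfπ, ha, hb, hc, hd]
    decide

/-- A permutation is an arc permutation iff it avoids the eight patterns
1324, 1342, 2413, 2431, 3124, 3142, 4213, 4231. -/
theorem stmt4 (n : ℕ) (hn : 1 ≤ n) (π : Equiv.Perm (Fin n)) :
    IsArc π ↔
      (Avoids π p1324 ∧ Avoids π p1342 ∧ Avoids π p2413 ∧ Avoids π p2431 ∧
       Avoids π p3124 ∧ Avoids π p3142 ∧ Avoids π p4213 ∧ Avoids π p4231) := by
  rw [isArc_iff_not_interleaves,
    avoids_four_iff π (τ := p1324) (a := 0) (b := 2) (c := 1) (d := 3) rfl rfl rfl rfl,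
    avoids_four_iff π (τ := p1342) (a := 0) (b := 3) (c := 1) (d := 2) rfl rfl rfl rfl,
    avoids_four_iff π (τ := p2413) (a := 2) (b := 0) (c := 3) (d := 1) rfl rfl rfl rfl,
    avoids_four_iff π (τ := p2431) (a := 3) (b := 0) (c := 2) (d := 1) rfl rfl rfl rfl,
    avoids_four_iff π (τ := p3124) (a := 1) (b := 2) (c := 0) (d := 3) rfl rfl rfl rfl,
    avoids_four_iff π (τ := p3142) (a := 1) (b := 3) (c := 0) (d := 2) rfl rfl rfl rfl,
    avoids_four_iff π (τ := p4213) (a := 2) (b := 1) (c := 3) (d := 0) rfl rfl rfl rfl,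
    avoids_four_iff π (τ := p4231) (a := 3) (b := 1) (c := 2) (d := 0) rfl rfl rfl rfl]
  simp only [← forall_and]
  refine forall₄_congr fun w x y z => forall₃_congr fun _ _ _ => ?_
  simp only [← not_or]
  rfl
end

section
/- For every n ≥ 1, a permutation in S_n is unimodal if and only if it avoids all ten patterns 1324, 1342, 2143, 2413, 2431, 3124, 3142, 3412, 4213, 4231; that is, U_n = S_n(1324, 1342, 2143, 2413, 2431, 3124, 3142, 3412, 4213, 4231). -/
/-- A finset of `Fin n` is an interval of consecutive integers:
it is closed under betweenness. -/
def IsIntervalFinset {n : ℕ} (S : Finset (Fin n)) : Prop :=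
  ∀ x ∈ S, ∀ y ∈ S, ∀ z : Fin n, x ≤ z → z ≤ y → z ∈ S

/-- The set of letters in positions `j, j+1, …, n-1` (0-indexed suffix) of `π`. -/
def sufSet {n : ℕ} (π : Equiv.Perm (Fin n)) (j : Fin n) : Finset (Fin n) :=
  (Finset.Ici j).image π

/-- A permutation is unimodal if every prefix set is an interval of consecutive
integers, or every suffix set is an interval of consecutive integers. -/
def IsUnimodal {n : ℕ} (π : Equiv.Perm (Fin n)) : Prop :=
  (∀ j : Fin n, IsIntervalFinset (prefSet π j)) ∨
  (∀ j : Fin n, IsIntervalFinset (sufSet π j))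

/-- Some letter of `f` lies strictly between two letters preceding it, i.e. `f` contains the
pattern 132 or the pattern 312. -/
def LastBetween {α β : Type*} [LT α] [LT β] (f : α → β) : Prop :=
  ∃ x y z, x < y ∧ y < z ∧ (f x < f z ∧ f z < f y ∨ f y < f z ∧ f z < f x)

/-- Some letter of `f` lies strictly between two letters following it, i.e. `f` contains the
pattern 213 or the pattern 231. -/
def FirstBetween {α β : Type*} [LT α] [LT β] (f : α → β) : Prop :=
  ∃ x y z, x < y ∧ y < z ∧ (f y < f x ∧ f x < f z ∨ f z < f x ∧ f x < f y)

theorem forall_isIntervalFinset_prefSet_iff {n : ℕ} (π : Equiv.Perm (Fin n)) :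
    (∀ j, IsIntervalFinset (prefSet π j)) ↔ ¬ LastBetween π := by
  constructor
  · rintro h ⟨x, y, z, hxy, hyz, hb⟩
    have hx : π x ∈ prefSet π y := Finset.mem_image_of_mem _ (Finset.mem_Iic.2 hxy.le)
    have hy : π y ∈ prefSet π y := Finset.mem_image_of_mem _ (Finset.mem_Iic.2 le_rfl)
    have hz : π z ∈ prefSet π y := by
      rcases hb with hb | hb
      · exact h y _ hx _ hy _ hb.1.le hb.2.le
      · exact h y _ hy _ hx _ hb.1.le hb.2.le
    simp only [prefSet, Finset.mem_image, Finset.mem_Iic, π.apply_eq_iff_eq, exists_eq_right] at hz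
    exact hz.not_gt hyz
  · intro h j u hu v hv w huw hwv
    obtain ⟨z, rfl⟩ := π.surjective w
    simp only [prefSet, Finset.mem_image, Finset.mem_Iic] at hu hv ⊢
    obtain ⟨x, hx, rfl⟩ := hu
    obtain ⟨y, hy, rfl⟩ := hv
    refine ⟨z, ?_, rfl⟩
    by_contra! hz
    have hxz : π x < π z := huw.lt_of_ne (π.injective.ne (hx.trans_lt hz).ne)
    have hzy : π z < π y := hwv.lt_of_ne (π.injective.ne (hy.trans_lt hz).ne')
    rcases lt_trichotomy x y with hxy | rfl | hxy
    · exact h ⟨x, y, z, hxy, hy.trans_lt hz, .inl ⟨hxz, hzy⟩⟩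
    · exact hxz.asymm hzy
    · exact h ⟨y, x, z, hxy, hx.trans_lt hz, .inr ⟨hxz, hzy⟩⟩

theorem forall_isIntervalFinset_sufSet_iff {n : ℕ} (π : Equiv.Perm (Fin n)) :
    (∀ j, IsIntervalFinset (sufSet π j)) ↔ ¬ FirstBetween π := by
  constructor
  · rintro h ⟨x, y, z, hxy, hyz, hb⟩
    have hz : π z ∈ sufSet π y := Finset.mem_image_of_mem _ (Finset.mem_Ici.2 hyz.le)
    have hy : π y ∈ sufSet π y := Finset.mem_image_of_mem _ (Finset.mem_Ici.2 le_rfl)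
    have hx : π x ∈ sufSet π y := by
      rcases hb with hb | hb
      · exact h y _ hy _ hz _ hb.1.le hb.2.le
      · exact h y _ hz _ hy _ hb.1.le hb.2.le
    simp only [sufSet, Finset.mem_image, Finset.mem_Ici, π.apply_eq_iff_eq, exists_eq_right] at hx
    exact hx.not_gt hxy
  · intro h j u hu v hv w huw hwv
    obtain ⟨x, rfl⟩ := π.surjective w
    simp only [sufSet, Finset.mem_image, Finset.mem_Ici] at hu hv ⊢
    obtain ⟨y, hy, rfl⟩ := hu
    obtain ⟨z, hz, rfl⟩ := hv
    refine ⟨x, ?_, rfl⟩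
    by_contra! hx
    have hyx : π y < π x := huw.lt_of_ne (π.injective.ne (hx.trans_le hy).ne')
    have hxz : π x < π z := hwv.lt_of_ne (π.injective.ne (hx.trans_le hz).ne)
    rcases lt_trichotomy y z with hyz | rfl | hyz
    · exact h ⟨x, y, z, hx.trans_le hy, hyz, .inl ⟨hyx, hxz⟩⟩
    · exact hyx.asymm hxz
    · exact h ⟨x, z, y, hx.trans_le hz, hyz, .inr ⟨hyx, hxz⟩⟩

theorem isUnimodal_iff {n : ℕ} (π : Equiv.Perm (Fin n)) :
    IsUnimodal π ↔ ¬ (LastBetween π ∧ FirstBetween π) := by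
  rw [IsUnimodal, forall_isIntervalFinset_prefSet_iff, forall_isIntervalFinset_sufSet_iff,
    not_and_or]

theorem Contains.lastBetween {n k : ℕ} {π : Equiv.Perm (Fin n)} {τ : Equiv.Perm (Fin k)}
    (h : Contains π τ) (hτ : LastBetween τ) : LastBetween π := by
  obtain ⟨f, hf, hπ⟩ := h
  obtain ⟨x, y, z, hxy, hyz, hb⟩ := hτ
  exact ⟨f x, f y, f z, hf hxy, hf hyz, by simpa only [hπ] using hb⟩

theorem Contains.firstBetween {n k : ℕ} {π : Equiv.Perm (Fin n)} {τ : Equiv.Perm (Fin k)}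
    (h : Contains π τ) (hτ : FirstBetween τ) : FirstBetween π := by
  obtain ⟨f, hf, hπ⟩ := h
  obtain ⟨x, y, z, hxy, hyz, hb⟩ := hτ
  exact ⟨f x, f y, f z, hf hxy, hf hyz, by simpa only [hπ] using hb⟩

theorem IsUnimodal.avoids {n k : ℕ} {π : Equiv.Perm (Fin n)} (hπ : IsUnimodal π)
    {τ : Equiv.Perm (Fin k)} (hτ : LastBetween τ ∧ FirstBetween τ) : Avoids π τ :=
  fun h => (isUnimodal_iff π).1 hπ ⟨h.lastBetween hτ.1, h.firstBetween hτ.2⟩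

/-- To exhibit a pattern of length four it suffices to list its occurrence in increasing order
of positions, and to check that the letters, listed by value, increase. -/
theorem contains_mkPerm {n : ℕ} {π : Equiv.Perm (Fin n)} {g : Fin 4 → Fin 4}
    {hg : Function.Bijective g} {a b c d : Fin n} (hab : a < b) (hbc : b < c) (hcd : c < d)
    (h : ∀ x y, g x < g y → π (![a, b, c, d] x) < π (![a, b, c, d] y)) :
    Contains π (mkPerm g hg) := by
  refine ⟨![a, b, c, d], ?_, fun x y => ⟨fun hxy => ?_, h x y⟩⟩
  · rw [Fin.strictMono_iff_lt_succ]
    intro i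
    fin_cases i <;> simpa
  · change g x < g y
    by_contra! hle
    rcases hle.lt_or_eq with hlt | heq
    · exact hxy.asymm (h y x hlt)
    · exact hxy.ne (by rw [hg.1 heq])

/-- `f` avoids the ten patterns of length four that contain both one of 132, 312 and one of 213,
231. -/
def AvoidsTen {α β : Type*} [LT α] [LT β] (f : α → β) : Prop :=
  ∀ a b c d, a < b → b < c → c < d →
    ¬ (f a < f c ∧ f c < f b ∧ f b < f d) ∧
    ¬ (f a < f d ∧ f d < f b ∧ f b < f c) ∧
    ¬ (f b < f a ∧ f a < f d ∧ f d < f c) ∧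
    ¬ (f c < f a ∧ f a < f d ∧ f d < f b) ∧
    ¬ (f d < f a ∧ f a < f c ∧ f c < f b) ∧
    ¬ (f b < f c ∧ f c < f a ∧ f a < f d) ∧
    ¬ (f b < f d ∧ f d < f a ∧ f a < f c) ∧
    ¬ (f c < f d ∧ f d < f a ∧ f a < f b) ∧
    ¬ (f c < f b ∧ f b < f d ∧ f d < f a) ∧
    ¬ (f d < f b ∧ f b < f c ∧ f c < f a)

section

variable {α β : Type*} [LinearOrder α] [LinearOrder β] {f : α → β} {a b c i j k : α}

theorem AvoidsTen.toDual_comp (H : AvoidsTen f) : AvoidsTen (OrderDual.toDual ∘ f) := by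
  intro a b c d hab hbc hcd
  obtain ⟨h1, h2, h3, h4, h5, h6, h7, h8, h9, h10⟩ := H a b c d hab hbc hcd
  exact ⟨fun h => h10 ⟨h.2.2, h.2.1, h.1⟩, fun h => h9 ⟨h.2.2, h.2.1, h.1⟩,
    fun h => h8 ⟨h.2.2, h.2.1, h.1⟩, fun h => h7 ⟨h.2.2, h.2.1, h.1⟩,
    fun h => h6 ⟨h.2.2, h.2.1, h.1⟩, fun h => h5 ⟨h.2.2, h.2.1, h.1⟩,
    fun h => h4 ⟨h.2.2, h.2.1, h.1⟩, fun h => h3 ⟨h.2.2, h.2.1, h.1⟩,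
    fun h => h2 ⟨h.2.2, h.2.1, h.1⟩, fun h => h1 ⟨h.2.2, h.2.1, h.1⟩⟩

theorem AvoidsTen.comp_ofDual (H : AvoidsTen f) : AvoidsTen (f ∘ OrderDual.ofDual) := by
  intro a b c d hab hbc hcd
  obtain ⟨h1, h2, h3, h4, h5, h6, h7, h8, h9, h10⟩ := H _ _ _ _ hcd hbc hab
  exact ⟨h10, h5, h8, h7, h2, h9, h4, h3, h6, h1⟩

/-- If `f k` lies between `f i` and `f j`, then a letter at or before position `i` and below
the other letters cannot precede a smaller letter. -/
theorem AvoidsTen.false_of_below (H : AvoidsTen f)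
    (hij : i < j) (hjk : j < k) (hP : f i < f k ∧ f k < f j ∨ f j < f k ∧ f k < f i)
    (hai : a ≤ i) (hi : f a ≤ f i) (hj : f a < f j) (hk : f a < f k) (hab : a < b)
    (hb : f b < f a) : False := by
  rcases lt_trichotomy b i with hbi | rfl | hib
  · have h := H a b j k hab (hbi.trans hij) hjk
    have h' := H a b i k hab hbi (hij.trans hjk)
    clear H
    grind
  · exact hi.not_gt hb
  rcases lt_trichotomy b j with hbj | rfl | hjb
  · rcases hai.eq_or_lt with rfl | hai
    · have h := H a b j k hab hbj hjk
      clear H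
      grind
    · have h := H a i b j hai hib hbj
      have h' := H i b j k hib hbj hjk
      clear H
      grind
  · exact hj.asymm hb
  rcases lt_trichotomy b k with hbk | rfl | hkb
  · have h := H i j b k hij hjb hbk
    clear H
    grind
  · exact hk.asymm hb
  · have h := H i j k b hij hjk hkb
    clear H
    grind

theorem AvoidsTen.lt_of_between (H : AvoidsTen f) (hf : f.Injective)
    (hij : i < j) (hjk : j < k) (hP : f i < f k ∧ f k < f j ∨ f j < f k ∧ f k < f i)
    (hab : a < b) (hac : a < c) (hb : f b < f a) (hc : f a < f c) : i < a := by
  by_contra! hai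
  have hcases : f a ≤ f i ∧ f a < f j ∧ f a < f k ∨ f i ≤ f a ∧ f j < f a ∧ f k < f a := by
    rcases hai.eq_or_lt with rfl | hai
    · grind
    · have h := H a i j k hai hij hjk
      have hi := hf.ne hai.ne
      have hj := hf.ne (hai.trans hij).ne
      have hk := hf.ne (hai.trans (hij.trans hjk)).ne
      clear H
      grind
  rcases hcases with ⟨hi, hj, hk⟩ | ⟨hi, hj, hk⟩
  · exact H.false_of_below hij hjk hP hai hi hj hk hab hb
  · exact H.toDual_comp.false_of_below hij hjk (hP.symm.imp And.symm And.symm) hai hi hj hk hac hc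

theorem AvoidsTen.not_lastBetween_and_firstBetween (H : AvoidsTen f) (hf : f.Injective) :
    ¬ (LastBetween f ∧ FirstBetween f) := by
  rintro ⟨⟨i, j, k, hij, hjk, hP⟩, ⟨a, b, c, hab, hbc, hS⟩⟩
  have hia : i < a := by
    rcases hS with hS | hS
    · exact H.lt_of_between hf hij hjk hP hab (hab.trans hbc) hS.1 hS.2
    · exact H.lt_of_between hf hij hjk hP (hab.trans hbc) hab hS.1 hS.2
  have hkc : k < c := by
    have hf' : (f ∘ OrderDual.ofDual).Injective := hf.comp OrderDual.ofDual.injective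
    rcases hP with hP | hP
    · exact H.comp_ofDual.lt_of_between (i := OrderDual.toDual c) (a := OrderDual.toDual k)
        (j := OrderDual.toDual b) (k := OrderDual.toDual a) (b := OrderDual.toDual i)
        (c := OrderDual.toDual j) hf' hbc hab hS.symm (hij.trans hjk) hjk hP.1 hP.2
    · exact H.comp_ofDual.lt_of_between (i := OrderDual.toDual c) (a := OrderDual.toDual k)
        (j := OrderDual.toDual b) (k := OrderDual.toDual a) (b := OrderDual.toDual j)
        (c := OrderDual.toDual i) hf' hbc hab hS.symm hjk (hij.trans hjk) hP.1 hP.2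
  have hcij : f i < f c ∧ f c < f j ∨ f j < f c ∧ f c < f i := by
    have h := H i j k c hij hjk hkc
    have hi := hf.ne (hij.trans (hjk.trans hkc)).ne
    have hj := hf.ne (hjk.trans hkc).ne
    have hk := hf.ne hkc.ne
    clear H
    grind
  have hibc : f b < f i ∧ f i < f c ∨ f c < f i ∧ f i < f b := by
    have h := H i a b c hia hab hbc
    have ha := hf.ne hia.ne
    have hb := hf.ne (hia.trans hab).ne
    have hc := hf.ne (hia.trans (hab.trans hbc)).ne
    clear H hcij
    grind
  clear hP hS
  rcases lt_trichotomy j b with hjb | rfl | hbj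
  · have h := H i j b c hij hjb hbc
    clear H
    grind
  · clear H
    grind
  · have h := H i b j c (hia.trans hab) hbj (hjk.trans hkc)
    clear H
    grind

end

theorem avoidsTen_of_avoids {n : ℕ} {π : Equiv.Perm (Fin n)}
    (h : Avoids π p1324 ∧ Avoids π p1342 ∧ Avoids π p2143 ∧ Avoids π p2413 ∧
      Avoids π p2431 ∧ Avoids π p3124 ∧ Avoids π p3142 ∧ Avoids π p3412 ∧
      Avoids π p4213 ∧ Avoids π p4231) : AvoidsTen π := by
  obtain ⟨h1, h2, h3, h4, h5, h6, h7, h8, h9, h10⟩ := h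
  intro a b c d hab hbc hcd
  refine ⟨fun _ => h1 ?_, fun _ => h2 ?_, fun _ => h3 ?_, fun _ => h4 ?_, fun _ => h5 ?_,
    fun _ => h6 ?_, fun _ => h7 ?_, fun _ => h8 ?_, fun _ => h9 ?_, fun _ => h10 ?_⟩ <;>
  · refine contains_mkPerm hab hbc hcd ?_
    simp [Fin.forall_fin_succ]
    grind

/-- A permutation is unimodal iff it avoids the ten patterns
1324, 1342, 2143, 2413, 2431, 3124, 3142, 3412, 4213, 4231. -/
theorem stmt5 (n : ℕ) (hn : 1 ≤ n) (π : Equiv.Perm (Fin n)) :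
    IsUnimodal π ↔
      (Avoids π p1324 ∧ Avoids π p1342 ∧ Avoids π p2143 ∧ Avoids π p2413 ∧
       Avoids π p2431 ∧ Avoids π p3124 ∧ Avoids π p3142 ∧ Avoids π p3412 ∧
       Avoids π p4213 ∧ Avoids π p4231) := by
  constructor
  · intro h
    refine ⟨?_, ?_, ?_, ?_, ?_, ?_, ?_, ?_, ?_, ?_⟩ <;> apply h.avoids <;>
    · simp only [LastBetween, FirstBetween, p1324, p1342, p2143, p2413, p2431, p3124, p3142,
        p3412, p4213, p4231, mkPerm, Equiv.ofBijective_apply]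
      decide
  · exact fun h => (isUnimodal_iff π).2
      ((avoidsTen_of_avoids h).not_lastBetween_and_firstBetween π.injective)
end

section
/- For every n ≥ 1, an arc permutation π ∈ A_n is unimodal if and only if π avoids both patterns 2143 and 3412; that is, U_n = A_n ∩ S_n(2143, 3412). -/
lemma mem_prefSet {n : ℕ} (π : Equiv.Perm (Fin n)) (j x : Fin n) :
    x ∈ prefSet π j ↔ π.symm x ≤ j := by
  simp [prefSet, ← Equiv.eq_symm_apply]

lemma mem_sufSet {n : ℕ} (π : Equiv.Perm (Fin n)) (j x : Fin n) :
    x ∈ sufSet π j ↔ j ≤ π.symm x := by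
  simp [sufSet, ← Equiv.eq_symm_apply]

/-- Membership in the cyclic interval of length `k` starting at `a`, in terms of inequalities. -/
lemma exists_lt_natCast_eq_add_iff {n a k : ℕ} (ha : a ≤ n) (x : Fin n) :
    (∃ i < k, ((x : ℕ) : ZMod n) = (a : ZMod n) + (i : ZMod n)) ↔
      (a ≤ x ∧ x < a + k) ∨ x + n < a + k := by
  have hx := x.isLt
  constructor
  · rintro ⟨i, hi, h⟩
    rw [← Nat.cast_add, ZMod.natCast_eq_natCast_iff, Nat.ModEq, Nat.mod_eq_of_lt hx] at h
    have hdiv := Nat.div_add_mod (a + i) n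
    rw [← h] at hdiv
    rcases Nat.eq_zero_or_pos ((a + i) / n) with h0 | h0
    · rw [h0] at hdiv
      omega
    · have := Nat.le_mul_of_pos_right n h0
      omega
  · rintro (⟨h₁, h₂⟩ | h)
    · refine ⟨x - a, by omega, ?_⟩
      rw [← Nat.cast_add, Nat.add_sub_cancel' h₁]
    · refine ⟨x + n - a, by omega, ?_⟩
      rw [← Nat.cast_add, Nat.add_sub_cancel' (by omega)]
      simp

lemma IsCyclicIntervalFinset.exists_mem_iff {n : ℕ} {S : Finset (Fin n)}
    (hS : IsCyclicIntervalFinset S) (hn : 0 < n) :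
    ∃ a k : ℕ, a ≤ n ∧ ∀ x : Fin n, x ∈ S ↔ (a ≤ x ∧ x < a + k) ∨ x + n < a + k := by
  obtain ⟨a, k, h⟩ := hS
  refine ⟨a % n, k, (Nat.mod_lt _ hn).le, fun x => ?_⟩
  rw [h, ← exists_lt_natCast_eq_add_iff (Nat.mod_lt _ hn).le, ZMod.natCast_mod]

lemma isCyclicIntervalFinset_of_mem_iff {n : ℕ} {S : Finset (Fin n)} (a k : ℕ) (ha : a ≤ n)
    (h : ∀ x : Fin n, x ∈ S ↔ (a ≤ x ∧ x < a + k) ∨ x + n < a + k) :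
    IsCyclicIntervalFinset S :=
  ⟨a, k, fun x => by rw [h, exists_lt_natCast_eq_add_iff ha]⟩

/-- Four points in increasing order cannot alternate between a cyclic interval and its
complement. -/
lemma IsCyclicIntervalFinset.not_alternating {n : ℕ} {S : Finset (Fin n)}
    (hS : IsCyclicIntervalFinset S) {a b c d : Fin n} (hab : a < b) (hbc : b < c) (hcd : c < d) :
    ¬ (a ∈ S ∧ b ∉ S ∧ c ∈ S ∧ d ∉ S) ∧ ¬ (a ∉ S ∧ b ∈ S ∧ c ∉ S ∧ d ∈ S) := by
  obtain ⟨s, k, -, h⟩ := hS.exists_mem_iff a.pos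
  have := d.isLt
  simp only [h, Fin.lt_def] at *
  omega

lemma IsIntervalFinset.mem_iff {n : ℕ} {S : Finset (Fin n)} (hS : IsIntervalFinset S)
    (hne : S.Nonempty) (x : Fin n) : x ∈ S ↔ S.min' hne ≤ x ∧ x ≤ S.max' hne :=
  ⟨fun hx => ⟨S.min'_le x hx, S.le_max' x hx⟩,
    fun hx => hS _ (S.min'_mem hne) _ (S.max'_mem hne) x hx.1 hx.2⟩

lemma IsIntervalFinset.isCyclicIntervalFinset {n : ℕ} {S : Finset (Fin n)}
    (hS : IsIntervalFinset S) : IsCyclicIntervalFinset S := by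
  rcases S.eq_empty_or_nonempty with rfl | hne
  · exact ⟨0, 0, by simp⟩
  · have hle := S.min'_le_max' hne
    refine isCyclicIntervalFinset_of_mem_iff (S.min' hne) (S.max' hne + 1 - S.min' hne)
      (S.min' hne).isLt.le fun x => ?_
    rw [hS.mem_iff hne]
    have := (S.max' hne).isLt
    simp only [Fin.le_def] at *
    omega

lemma IsIntervalFinset.isCyclicIntervalFinset_compl {n : ℕ} {S : Finset (Fin n)}
    (hS : IsIntervalFinset S) : IsCyclicIntervalFinset Sᶜ := by
  rcases S.eq_empty_or_nonempty with rfl | hne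
  · exact isCyclicIntervalFinset_of_mem_iff 0 n (Nat.zero_le _) (by simp)
  · have hle := S.min'_le_max' hne
    have := (S.max' hne).isLt
    refine isCyclicIntervalFinset_of_mem_iff (S.max' hne + 1) (n + S.min' hne - (S.max' hne + 1))
      this fun x => ?_
    have := x.isLt
    rw [Finset.mem_compl, hS.mem_iff hne]
    simp only [Fin.le_def] at *
    omega

lemma IsUnimodal.isArc {n : ℕ} {π : Equiv.Perm (Fin n)} (h : IsUnimodal π) : IsArc π := by
  intro j
  rcases h with h | h
  · exact (h j).isCyclicIntervalFinset
  · have hc : IsIntervalFinset (prefSet π j)ᶜ := by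
      intro x hx y hy z hxz hzy
      simp only [Finset.mem_compl, mem_prefSet, not_le] at hx hy ⊢
      have hj : (j : ℕ) + 1 < n := lt_of_le_of_lt hx (π.symm x).isLt
      have := h ⟨j + 1, hj⟩ x ((mem_sufSet ..).2 hx) y ((mem_sufSet ..).2 hy) z hxz hzy
      exact (mem_sufSet ..).1 this
    simpa using hc.isCyclicIntervalFinset_compl

lemma IsUnimodal.avoids_s6 {n : ℕ} {π : Equiv.Perm (Fin n)} (h : IsUnimodal π) :
    Avoids π p2143 ∧ Avoids π p3412 := by
  constructor
  · rintro ⟨f, hf, hp⟩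
    have h10 : π (f 1) < π (f 0) := (hp 1 0).2 (by simp [p2143, mkPerm])
    have h03 : π (f 0) < π (f 3) := (hp 0 3).2 (by simp [p2143, mkPerm])
    have h32 : π (f 3) < π (f 2) := (hp 3 2).2 (by simp [p2143, mkPerm])
    have f01 : f 0 < f 1 := hf (by decide)
    have f12 : f 1 < f 2 := hf (by decide)
    have f23 : f 2 < f 3 := hf (by decide)
    rcases h with h | h
    · have := h (f 2) (π (f 0)) (by simpa [mem_prefSet] using (f01.trans f12).le) (π (f 2))
        (by simp [mem_prefSet]) (π (f 3)) h03.le h32.le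
      simp only [mem_prefSet, Equiv.symm_apply_apply] at this
      exact this.not_gt f23
    · have := h (f 1) (π (f 1)) (by simp [mem_sufSet]) (π (f 3))
        (by simpa [mem_sufSet] using (f12.trans f23).le) (π (f 0)) h10.le h03.le
      simp only [mem_sufSet, Equiv.symm_apply_apply] at this
      exact this.not_gt f01
  · rintro ⟨f, hf, hp⟩
    have h23 : π (f 2) < π (f 3) := (hp 2 3).2 (by simp [p3412, mkPerm])
    have h30 : π (f 3) < π (f 0) := (hp 3 0).2 (by simp [p3412, mkPerm])
    have h01 : π (f 0) < π (f 1) := (hp 0 1).2 (by simp [p3412, mkPerm])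
    have f01 : f 0 < f 1 := hf (by decide)
    have f12 : f 1 < f 2 := hf (by decide)
    have f23 : f 2 < f 3 := hf (by decide)
    rcases h with h | h
    · have := h (f 2) (π (f 2)) (by simp [mem_prefSet]) (π (f 0))
        (by simpa [mem_prefSet] using (f01.trans f12).le) (π (f 3)) h23.le h30.le
      simp only [mem_prefSet, Equiv.symm_apply_apply] at this
      exact this.not_gt f23
    · have := h (f 1) (π (f 3)) (by simpa [mem_sufSet] using (f12.trans f23).le) (π (f 1))
        (by simp [mem_sufSet]) (π (f 0)) h30.le h01.le
      simp only [mem_sufSet, Equiv.symm_apply_apply] at this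
      exact this.not_gt f01

lemma strictMono_vec_four {α : Type*} [Preorder α] {a b c d : α} (hab : a < b) (hbc : b < c)
    (hcd : c < d) : StrictMono ![a, b, c, d] := by
  rw [Fin.strictMono_iff_lt_succ]
  intro i
  fin_cases i <;> simpa

lemma contains_p2143 {n : ℕ} {π : Equiv.Perm (Fin n)} {a b c d : Fin n}
    (hab : π.symm a < π.symm b) (hbc : π.symm b < π.symm c) (hcd : π.symm c < π.symm d)
    (hba : b < a) (had : a < d) (hdc : d < c) : Contains π p2143 := by
  refine ⟨_, strictMono_vec_four hab hbc hcd, fun i j => ?_⟩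
  fin_cases i <;> fin_cases j <;> simp [p2143, mkPerm] <;> order

lemma contains_p3412 {n : ℕ} {π : Equiv.Perm (Fin n)} {a b c d : Fin n}
    (hab : π.symm a < π.symm b) (hbc : π.symm b < π.symm c) (hcd : π.symm c < π.symm d)
    (hcd' : c < d) (hda : d < a) (hab' : a < b) : Contains π p3412 := by
  refine ⟨_, strictMono_vec_four hab hbc hcd, fun i j => ?_⟩
  fin_cases i <;> fin_cases j <;> simp [p3412, mkPerm] <;> order

lemma IsIntervalFinset.of_forall_lt {n : ℕ} {S : Finset (Fin n)}
    (h : ∀ x ∈ S, ∀ y ∈ S, ∀ z, x < z → z < y → z ∈ S) : IsIntervalFinset S := by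
  intro x hx y hy z hxz hzy
  rcases hxz.eq_or_lt with rfl | hxz
  · exact hx
  rcases hzy.eq_or_lt with rfl | hzy
  · exact hy
  exact h x hx y hy z hxz hzy

/-- A letter which lies between two letters preceding it in an arc permutation is preceded by both
the smallest and the largest letter. -/
lemma IsArc.exists_of_not_prefix {n : ℕ} {π : Equiv.Perm (Fin (n + 1))} (hπ : IsArc π)
    (h : ¬ ∀ j, IsIntervalFinset (prefSet π j)) :
    ∃ z, 0 < z ∧ z < Fin.last n ∧ π.symm 0 < π.symm z ∧ π.symm (Fin.last n) < π.symm z := by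
  obtain ⟨j, hj⟩ := not_forall.1 h
  obtain ⟨x, hx, y, hy, z, hxz, hzy, hz⟩ : ∃ x ∈ prefSet π j, ∃ y ∈ prefSet π j,
      ∃ z, x < z ∧ z < y ∧ z ∉ prefSet π j := by
    by_contra! hcon
    exact hj (.of_forall_lt hcon)
  have h0 : 0 ∈ prefSet π j := by
    by_contra h0
    have h0x : 0 < x := Fin.pos_of_ne_zero fun h => h0 (h ▸ hx)
    exact ((hπ j).not_alternating h0x hxz hzy).2 ⟨h0, hx, hz, hy⟩
  have hl : Fin.last n ∈ prefSet π j := by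
    by_contra hl
    have hyl : y < Fin.last n := Fin.lt_last_iff_ne_last.2 fun h => hl (h ▸ hy)
    exact ((hπ j).not_alternating hxz hzy hyl).1 ⟨hx, hz, hy, hl⟩
  rw [mem_prefSet] at h0 hl hz
  exact ⟨z, (Fin.zero_le x).trans_lt hxz, hzy.trans_le (Fin.le_last y), by order, by order⟩

/-- A letter which lies between two letters following it in an arc permutation is followed by both
the smallest and the largest letter. -/
lemma IsArc.exists_of_not_suffix {n : ℕ} {π : Equiv.Perm (Fin (n + 1))} (hπ : IsArc π)
    (h : ¬ ∀ j, IsIntervalFinset (sufSet π j)) :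
    ∃ z, 0 < z ∧ z < Fin.last n ∧ π.symm z < π.symm 0 ∧ π.symm z < π.symm (Fin.last n) := by
  obtain ⟨j, hj⟩ := not_forall.1 h
  obtain ⟨x, hx, y, hy, z, hxz, hzy, hz⟩ : ∃ x ∈ sufSet π j, ∃ y ∈ sufSet π j,
      ∃ z, x < z ∧ z < y ∧ z ∉ sufSet π j := by
    by_contra! hcon
    exact hj (.of_forall_lt hcon)
  rw [mem_sufSet] at hx hy hz
  have hz' := (mem_prefSet π _ z).2 le_rfl
  have hx' : x ∉ prefSet π (π.symm z) := by rw [mem_prefSet]; order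
  have hy' : y ∉ prefSet π (π.symm z) := by rw [mem_prefSet]; order
  have h0 : 0 ∉ prefSet π (π.symm z) := by
    intro h0
    have h0x : 0 < x := Fin.pos_of_ne_zero fun h => hx' (h ▸ h0)
    exact ((hπ _).not_alternating h0x hxz hzy).1 ⟨h0, hx', hz', hy'⟩
  have hl : Fin.last n ∉ prefSet π (π.symm z) := by
    intro hl
    have hyl : y < Fin.last n := Fin.lt_last_iff_ne_last.2 fun h => hy' (h ▸ hl)
    exact ((hπ _).not_alternating hxz hzy hyl).2 ⟨hx', hz', hy', hl⟩
  rw [mem_prefSet, not_le] at h0 hl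
  exact ⟨z, (Fin.zero_le x).trans_lt hxz, hzy.trans_le (Fin.le_last y), h0, hl⟩

lemma IsArc.isUnimodal {n : ℕ} {π : Equiv.Perm (Fin (n + 1))} (hπ : IsArc π)
    (h₁ : Avoids π p2143) (h₂ : Avoids π p3412) : IsUnimodal π := by
  by_contra hU
  obtain ⟨hpre, hsuf⟩ := not_or.1 hU
  obtain ⟨z, hz0, hzl, h0z, hlz⟩ := hπ.exists_of_not_prefix hpre
  obtain ⟨w, hw0, hwl, hw0', hwl'⟩ := hπ.exists_of_not_suffix hsuf
  have hne : w ≠ z := by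
    rintro rfl
    order
  have h0l : π.symm 0 ≠ π.symm (Fin.last n) := π.symm.injective.ne (hz0.trans hzl).ne
  rcases h0l.lt_or_gt with h0l | h0l
  · rcases hne.lt_or_gt with hwz | hwz
    · exact h₁ (contains_p2143 hw0' h0l hlz hw0 hwz hzl)
    · refine ((hπ (π.symm 0)).not_alternating hz0 hwz hwl).1 ?_
      simp only [mem_prefSet, not_le]
      exact ⟨le_rfl, h0z, hw0'.le, h0l⟩
  · rcases hne.lt_or_gt with hwz | hwz
    · refine ((hπ (π.symm (Fin.last n))).not_alternating hw0 hwz hzl).2 ?_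
      simp only [mem_prefSet, not_le]
      exact ⟨h0l, hwl'.le, hlz, le_rfl⟩
    · exact h₂ (contains_p3412 hwl' h0l h0z hz0 hwz hwl)

/-- An arc permutation is unimodal iff it avoids the patterns 2143 and 3412;
that is, `U_n = A_n ∩ S_n(2143, 3412)`. -/
theorem stmt6 (n : ℕ) (hn : 1 ≤ n) (π : Equiv.Perm (Fin n)) :
    IsUnimodal π ↔ (IsArc π ∧ Avoids π p2143 ∧ Avoids π p3412) := by
  refine ⟨fun h => ⟨h.isArc, h.avoids_s6⟩, fun ⟨hπ, h₁, h₂⟩ => ?_⟩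
  obtain ⟨m, rfl⟩ := Nat.exists_eq_add_of_le' hn
  exact hπ.isUnimodal h₁ h₂
end

section
/- For every n ≥ 2, the maps ρ_0, ρ_1, …, ρ_{n−2} : A_n → A_n satisfy the Coxeter relations of the affine Weyl group C̃_{n−2}: (a) ρ_i ∘ ρ_i is the identity map for all 0 ≤ i ≤ n−2; (b) ρ_i ∘ ρ_j = ρ_j ∘ ρ_i whenever |i − j| > 1; (c) (ρ_i ∘ ρ_{i+1})^3 is the identity map for all 1 ≤ i ≤ n−4; (d) (ρ_i ∘ ρ_{i+1})^4 is the identity map for i = 0 and for i = n−3 (when these indices are in range). -/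
/-- The map `ρ_i` on arc permutations (`i` 0-indexed, acting on 0-indexed
positions `i` and `i+1`, i.e. by right multiplication by the adjacent
transposition `σ_{i+1}` of the paper): multiply on the right by the swap of
positions `i`, `i+1` if the result is an arc permutation, else do nothing. -/
noncomputable def rho {n : ℕ} (i : ℕ) (π : {π : Equiv.Perm (Fin n) // IsArc π}) :
    {π : Equiv.Perm (Fin n) // IsArc π} :=
  if h1 : i + 1 < n then
    haveI := Classical.dec
      (IsArc (π.val * Equiv.swap (⟨i, Nat.lt_of_succ_lt h1⟩ : Fin n) ⟨i + 1, h1⟩))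
    (if h2 : IsArc (π.val * Equiv.swap (⟨i, Nat.lt_of_succ_lt h1⟩ : Fin n) ⟨i + 1, h1⟩) then
      ⟨_, h2⟩
    else π)
  else π

open Equiv

/-- A subset of `ZMod n` consisting of consecutive residues. -/
def IsArcSet {n : ℕ} (S : Set (ZMod n)) : Prop :=
  ∃ (a : ZMod n) (k : ℕ), ∀ x, x ∈ S ↔ ∃ i < k, x = a + (i : ZMod n)

namespace IsArcSet

variable {n : ℕ} {S I : Set (ZMod n)} {x y z : ZMod n}

theorem empty : IsArcSet (∅ : Set (ZMod n)) := ⟨0, 0, by simp⟩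

theorem singleton (x : ZMod n) : IsArcSet ({x} : Set (ZMod n)) := ⟨x, 1, by simp⟩

theorem compl [NeZero n] (h : IsArcSet S) : IsArcSet Sᶜ := by
  obtain ⟨a, k, h⟩ := h
  have key : ∀ x i, i < n → x = a + (i : ZMod n) → (x ∈ S ↔ i < k) := by
    intro x i hi hx
    rw [h]
    constructor
    · rintro ⟨j, hj, hxj⟩
      rw [hx, add_right_inj, ZMod.natCast_eq_natCast_iff'] at hxj
      rw [Nat.mod_eq_of_lt hi] at hxj
      have := Nat.mod_le j n
      omega
    · intro hk
      exact ⟨i, hk, hx⟩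
  refine ⟨a + (k : ZMod n), n - k, fun x => ?_⟩
  rw [Set.mem_compl_iff]
  have hx : x = a + (((x - a).val : ℕ) : ZMod n) := by simp
  constructor
  · intro hxS
    rw [key x _ (ZMod.val_lt _) hx, not_lt] at hxS
    have := ZMod.val_lt (x - a)
    refine ⟨(x - a).val - k, by omega, ?_⟩
    rw [add_assoc, ← Nat.cast_add, Nat.add_sub_cancel' hxS]
    exact hx
  · rintro ⟨j, hj, hxj⟩
    rw [key x (k + j) (by omega) (by rw [hxj]; push_cast; ring)]
    omega

theorem compl_iff [NeZero n] : IsArcSet Sᶜ ↔ IsArcSet S :=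
  ⟨fun h => by simpa using h.compl, compl⟩

theorem eq_of_sub_one_mem (h : IsArcSet I) (hx : x ∉ I) (hx' : x - 1 ∈ I)
    (hy : y ∉ I) (hy' : y - 1 ∈ I) : x = y := by
  obtain ⟨a, k, h⟩ := h
  have key : ∀ u, u ∉ I → u - 1 ∈ I → u = a + (k : ZMod n) := by
    intro u hu hu'
    obtain ⟨i, hi, hui⟩ := (h _).1 hu'
    have hui' : u = a + ((i + 1 : ℕ) : ZMod n) := by
      push_cast
      linear_combination hui
    have : i + 1 = k := by
      by_contra hne
      exact hu ((h _).2 ⟨i + 1, by omega, hui'⟩)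
    rw [hui', this]
  rw [key x hx hx', key y hy hy']

theorem eq_of_add_one_mem (h : IsArcSet I) (hx : x ∉ I) (hx' : x + 1 ∈ I)
    (hy : y ∉ I) (hy' : y + 1 ∈ I) : x = y := by
  obtain ⟨a, k, h⟩ := h
  have key : ∀ u, u ∉ I → u + 1 ∈ I → u = a - 1 := by
    intro u hu hu'
    obtain ⟨i, hi, hui⟩ := (h _).1 hu'
    rcases i with _ | i
    · push_cast at hui
      linear_combination hui
    · refine absurd ((h _).2 ⟨i, by omega, ?_⟩) hu
      push_cast at hui
      linear_combination hui
  rw [key x hx hx', key y hy hy']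

theorem insert_of_sub_one_mem (h : IsArcSet I) (hx : x ∉ I) (hx' : x - 1 ∈ I) :
    IsArcSet (insert x I) := by
  obtain ⟨a, k, h⟩ := h
  obtain ⟨i, hi, hxi⟩ := (h _).1 hx'
  have hxi' : x = a + ((i + 1 : ℕ) : ZMod n) := by
    push_cast
    linear_combination hxi
  have hik : i + 1 = k := by
    by_contra hne
    exact hx ((h _).2 ⟨i + 1, by omega, hxi'⟩)
  rw [hik] at hxi'
  refine ⟨a, k + 1, fun y => ?_⟩
  rw [Set.mem_insert_iff, h]
  constructor
  · rintro (rfl | ⟨j, hj, hy⟩)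
    · exact ⟨k, by omega, hxi'⟩
    · exact ⟨j, by omega, hy⟩
  · rintro ⟨j, hj, hy⟩
    rcases Nat.lt_succ_iff_lt_or_eq.1 hj with hj | rfl
    · exact Or.inr ⟨j, hj, hy⟩
    · exact Or.inl (hy.trans hxi'.symm)

theorem insert_of_add_one_mem (h : IsArcSet I) (hx : x ∉ I) (hx' : x + 1 ∈ I) :
    IsArcSet (insert x I) := by
  obtain ⟨a, k, h⟩ := h
  obtain ⟨i, hi, hxi⟩ := (h _).1 hx'
  have hxa : a = x + 1 := by
    rcases i with _ | i
    · simpa using hxi.symm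
    · refine absurd ((h _).2 ⟨i, by omega, ?_⟩) hx
      push_cast at hxi
      linear_combination hxi
  subst hxa
  refine ⟨x, k + 1, fun y => ?_⟩
  rw [Set.mem_insert_iff, h]
  constructor
  · rintro (rfl | ⟨j, hj, hy⟩)
    · exact ⟨0, by omega, by simp⟩
    · exact ⟨j + 1, by omega, by rw [hy]; push_cast; ring⟩
  · rintro ⟨j, hj, hy⟩
    rcases j with _ | j
    · left; simpa using hy
    · exact Or.inr ⟨j, by omega, by rw [hy]; push_cast; ring⟩

theorem adjacent_of_insert (h : IsArcSet (insert x I)) (hI : I.Nonempty) (hx : x ∉ I) :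
    x - 1 ∈ I ∨ x + 1 ∈ I := by
  obtain ⟨a, k, h⟩ := h
  obtain ⟨y, hy⟩ := hI
  have hyx : y ≠ x := fun e => hx (e ▸ hy)
  have : Nontrivial (ZMod n) := ⟨y, x, hyx⟩
  obtain ⟨i, hi, hxi⟩ := (h x).1 (Set.mem_insert _ _)
  obtain ⟨j, hj, hyj⟩ := (h y).1 (Set.mem_insert_of_mem _ hy)
  rcases i with _ | i
  · right
    have hk : 1 < k := by
      by_contra hk
      have : j = 0 := by omega
      subst this
      exact hyx (hyj.trans hxi.symm)
    have hmem := (h (x + 1)).2 ⟨1, hk, by rw [hxi]; simp⟩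
    simpa using hmem
  · left
    have hmem := (h (x - 1)).2 ⟨i, by omega, by rw [hxi]; push_cast; ring⟩
    simpa using hmem

theorem insert_iff (h : IsArcSet I) (hI : I.Nonempty) (hx : x ∉ I) :
    IsArcSet (insert x I) ↔ x - 1 ∈ I ∨ x + 1 ∈ I :=
  ⟨fun h' => h'.adjacent_of_insert hI hx,
    fun h' => h'.elim (h.insert_of_sub_one_mem hx) (h.insert_of_add_one_mem hx)⟩

/-- An arc has at most two neighbours. -/
theorem not_three_insert (h : IsArcSet I) (hI : I.Nonempty)
    (hx : x ∉ I) (hy : y ∉ I) (hz : z ∉ I) (hxy : x ≠ y) (hxz : x ≠ z) (hyz : y ≠ z)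
    (h1 : IsArcSet (insert x I)) (h2 : IsArcSet (insert y I)) : ¬ IsArcSet (insert z I) := by
  rw [h.insert_iff hI hx] at h1
  rw [h.insert_iff hI hy] at h2
  rw [h.insert_iff hI hz]
  intro h3
  have e1 := @eq_of_sub_one_mem n I
  have e2 := @eq_of_add_one_mem n I
  grind

theorem insert_insert_or (hz : z ∉ I) (hxz : x ≠ z) (hyz : y ≠ z)
    (h1 : IsArcSet (insert x I)) (h2 : IsArcSet (insert y I))
    (h3 : IsArcSet (insert z (insert y (insert x I)))) :
    IsArcSet (insert z (insert x I)) ∨ IsArcSet (insert z (insert y I)) := by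
  have h1' := h1.insert_iff (x := z) (by simp) (by simp [hz, hxz.symm])
  have h2' := h2.insert_iff (x := z) (by simp) (by simp [hz, hyz.symm])
  have h3' := h3.adjacent_of_insert (by simp) (by simp [hz, hxz.symm, hyz.symm])
  rw [h1', h2']
  simp only [Set.mem_insert_iff] at h3' ⊢
  tauto

theorem pair_iff (hxy : x ≠ y) : IsArcSet ({y, x} : Set (ZMod n)) ↔ y - 1 = x ∨ y + 1 = x :=
  (singleton x).insert_iff (by simp) (by simpa using hxy.symm)

theorem pair_iff_not_pair (hn : 4 ≤ n) (hxy : x ≠ y) (hxz : x ≠ z) (hyz : y ≠ z)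
    (h1 : IsArcSet ({y, x} : Set (ZMod n))) (h2 : IsArcSet ({z, y, x} : Set (ZMod n))) :
    IsArcSet ({z, x} : Set (ZMod n)) ↔ ¬ IsArcSet ({z, y} : Set (ZMod n)) := by
  have h2' := h2.adjacent_of_insert (by simp) (by simp [hxz.symm, hyz.symm])
  rw [pair_iff hxy] at h1
  rw [pair_iff hxz, pair_iff hyz]
  have small : ∀ k : ℕ, 0 < k → k < 4 → (k : ZMod n) ≠ 0 := by
    intro k hk hk' h0
    rw [ZMod.natCast_eq_zero_iff] at h0
    have := Nat.le_of_dvd hk h0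
    omega
  have s1 := small 1 (by norm_num) (by norm_num)
  have s2 := small 2 (by norm_num) (by norm_num)
  have s3 := small 3 (by norm_num) (by norm_num)
  push_cast at s1 s2 s3
  simp only [Set.mem_insert_iff, Set.mem_singleton_iff] at h2'
  grind

end IsArcSet

section Orders

variable {n : ℕ} [NeZero n] {I J : Set (ZMod n)} {x y z : ZMod n}

theorem isArcSet_insert_iff_of_compl (hxy : x ≠ y) (hxz : x ≠ z)
    (hJ : ∀ u, u ∈ J ↔ u ∉ I ∧ u ≠ x ∧ u ≠ y ∧ u ≠ z) (hy : y ∉ I) (hz : z ∉ I) :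
    IsArcSet (insert x I) ↔ IsArcSet (insert y (insert z J)) := by
  rw [← IsArcSet.compl_iff]
  refine iff_of_eq (congrArg _ ?_)
  ext u
  simp only [Set.mem_compl_iff, Set.mem_insert_iff]
  grind

theorem isArcSet_insert_insert_iff_of_compl (hz : z ∉ I) (hxz : x ≠ z) (hyz : y ≠ z)
    (hJ : ∀ u, u ∈ J ↔ u ∉ I ∧ u ≠ x ∧ u ≠ y ∧ u ≠ z) :
    IsArcSet (insert y (insert x I)) ↔ IsArcSet (insert z J) := by
  rw [← IsArcSet.compl_iff]
  refine iff_of_eq (congrArg _ ?_)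
  ext u
  simp only [Set.mem_compl_iff, Set.mem_insert_iff]
  grind

/-- Three letters `x`, `y`, `z` are added to a nonempty arc in this order, without exhausting
`ZMod n`: constraints on the other orders in which they can be added. -/
theorem insertion_orders_of_nonempty (hI : IsArcSet I) (hIne : I.Nonempty)
    (hne : (insert z (insert y (insert x I)))ᶜ.Nonempty)
    (hx : x ∉ I) (hy : y ∉ I) (hz : z ∉ I) (hxy : x ≠ y) (hxz : x ≠ z) (hyz : y ≠ z)
    (h1 : IsArcSet (insert x I)) (h2 : IsArcSet (insert y (insert x I)))
    (h3 : IsArcSet (insert z (insert y (insert x I)))) :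
    ¬ (IsArcSet (insert y I) ∧ IsArcSet (insert z I)) ∧
    ¬ (IsArcSet (insert z (insert x I)) ∧ IsArcSet (insert z (insert y I))) ∧
    (IsArcSet (insert y I) → IsArcSet (insert z (insert x I)) ∨ IsArcSet (insert z (insert y I))) ∧
    (IsArcSet (insert z (insert x I)) → IsArcSet (insert y I) ∨ IsArcSet (insert z I)) := by
  have hJ : ∀ u, u ∈ (insert z (insert y (insert x I)))ᶜ ↔ u ∉ I ∧ u ≠ x ∧ u ≠ y ∧ u ≠ z := by
    intro u
    simp only [Set.mem_compl_iff, Set.mem_insert_iff]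
    tauto
  have hJarc := h3.compl
  generalize (insert z (insert y (insert x I)))ᶜ = J at hne hJ hJarc
  have exy := (isArcSet_insert_insert_iff_of_compl hz hxz hyz hJ).1 h2
  have exz := isArcSet_insert_insert_iff_of_compl (x := x) (y := z) (z := y) (J := J)
    hy hxy hyz.symm (by grind)
  have eyz := isArcSet_insert_insert_iff_of_compl (x := y) (y := z) (z := x) (J := J)
    hx hxy.symm hxz.symm (by grind)
  have ey := isArcSet_insert_iff_of_compl (x := y) (y := x) (z := z) (J := J)
    hxy.symm hyz (by grind) hx hz
  have ez := isArcSet_insert_iff_of_compl (x := z) (y := x) (z := y) (J := J)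
    hxz.symm hyz.symm (by grind) hx hy
  have eI : IsArcSet (insert x (insert y (insert z J))) := by
    rw [← IsArcSet.compl_iff]
    convert hI using 1
    ext u
    simp only [Set.mem_compl_iff, Set.mem_insert_iff]
    grind
  have hxJ : x ∉ J := by simp [hJ]
  have hyJ : y ∉ J := by simp [hJ]
  have hzJ : z ∉ J := by simp [hJ]
  refine ⟨fun h => hI.not_three_insert hIne hx hy hz hxy hxz hyz h1 h.1 h.2,
    fun h => hJarc.not_three_insert hne hzJ hyJ hxJ hyz.symm hxz.symm hxy.symm exy
      (exz.1 h.1) (eyz.1 h.2),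
    fun h => h1.insert_insert_or hz hxz hyz h h3, fun h => ?_⟩
  rw [ey, ez]
  exact exy.insert_insert_or hxJ hxz.symm hxy.symm (exz.1 h) eI

/-- When the three letters complete an arc to all of `ZMod n`, exactly two of them can come
first. -/
theorem insertion_orders_of_univ (hn : 4 ≤ n) (hI : IsArcSet I)
    (huniv : insert z (insert y (insert x I)) = Set.univ)
    (hx : x ∉ I) (hy : y ∉ I) (hz : z ∉ I) (hxy : x ≠ y) (hxz : x ≠ z) (hyz : y ≠ z)
    (h1 : IsArcSet (insert x I)) :
    IsArcSet (insert y I) ↔ ¬ IsArcSet (insert z I) := by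
  have hu : ∀ u, u ∉ I → u ≠ x → u ≠ y → u ≠ z → False := by
    intro u h1 h2 h3 h4
    have : u ∈ insert z (insert y (insert x I)) := huniv ▸ Set.mem_univ u
    simp only [Set.mem_insert_iff] at this
    tauto
  have ex := isArcSet_insert_iff_of_compl (x := x) (y := y) (z := z) (J := ∅)
    hxy hxz (by grind) hy hz
  have ey := isArcSet_insert_iff_of_compl (x := y) (y := x) (z := z) (J := ∅)
    hxy.symm hyz (by grind) hx hz
  have ez := isArcSet_insert_iff_of_compl (x := z) (y := x) (z := y) (J := ∅)
    hxz.symm hyz.symm (by grind) hx hy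
  have hall : IsArcSet ({x, y, z} : Set (ZMod n)) := by
    rw [← IsArcSet.compl_iff]
    convert hI using 1
    ext u
    simp only [Set.mem_compl_iff, Set.mem_insert_iff, Set.mem_singleton_iff]
    grind
  simp only [insert_empty_eq] at ex ey ez
  rw [ey, ez]
  exact IsArcSet.pair_iff_not_pair hn hyz.symm hxz.symm hxy.symm (ex.1 h1) hall

end Orders

section PartialAction

variable {G : Type*} [Group G]

open Classical in
/-- Right multiplication by `s` wherever it preserves the property `V`. -/
noncomputable def stepWithin (V : G → Prop) (s u : G) : G :=
  if V (u * s) then u * s else u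

variable {V : G → Prop} {s t u : G}

theorem stepWithin_comm (hst : s * t = t * s) (hV : V (u * s * t) ↔ V (u * s) ∧ V (u * t)) :
    stepWithin V s (stepWithin V t u) = stepWithin V t (stepWithin V s u) := by
  have e : u * t * s = u * s * t := by rw [mul_assoc, ← hst, mul_assoc]
  by_cases h1 : V (u * s) <;> by_cases h2 : V (u * t) <;> simp [stepWithin, *]

theorem hexagon_relations (hs : s * s = 1) (ht : t * t = 1) (hst : s * t * s = t * s * t) :
    (u * s * s = u ∧ u * s * t * t = u * s ∧ u * s * t * s * s = u * s * t) ∧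
    (u * s * t * s * t = u * t * s ∧ u * t * s * s = u * t ∧ u * t * t = u) ∧
    u * t * s * t = u * s * t * s := by
  have hs' : s⁻¹ = s := inv_eq_of_mul_eq_one_left hs
  have ht' : t⁻¹ = t := inv_eq_of_mul_eq_one_left ht
  have es : ∀ v : G, v * s * s = v := fun v => by rw [mul_assoc, hs, mul_one]
  have et : ∀ v : G, v * t * t = v := fun v => by rw [mul_assoc, ht, mul_one]
  have est : ∀ v : G, v * s * t * s = v * t * s * t := fun v => by
    simpa only [mul_assoc] using congrArg (v * ·) hst
  exact ⟨⟨es _, et _, es _⟩, ⟨by rw [est, et], es _, et _⟩, (est u).symm⟩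

theorem stepWithin_iterate_three (hs : s * s = 1) (ht : t * t = 1)
    (hst : s * t * s = t * s * t) (hu : V u)
    (hV : (¬ V (u * s) ∧ ¬ V (u * t)) ∨
      (V (u * s) ∧ V (u * t) ∧ ¬ V (u * s * t) ∧ ¬ V (u * t * s)) ∨
      (V (u * s) ∧ V (u * s * t) ∧ ¬ V (u * s * t * s) ∧ ¬ V (u * t)) ∨
      (V (u * t) ∧ V (u * t * s) ∧ ¬ V (u * s * t * s) ∧ ¬ V (u * s))) :
    (stepWithin V s ∘ stepWithin V t)^[3] u = u := by
  obtain ⟨⟨e1, e2, e3⟩, ⟨e4, e5, e6⟩, e7⟩ := hexagon_relations (u := u) hs ht hst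
  simp only [Function.iterate_succ, Function.iterate_zero, Function.comp_apply, id]
  rcases hV with h | h | h | h <;> simp [stepWithin, *]

theorem stepWithin_iterate_four_of_left (hs : s * s = 1) (ht : t * t = 1)
    (hst : s * t * s = t * s * t) (hu : V u) (h1 : V (u * s))
    (h2 : V (u * s * t * s) ↔ V (u * s * t)) (h3 : V (u * t) ↔ ¬ V (u * s * t))
    (h4 : V (u * t * s) ↔ ¬ V (u * s * t)) :
    (stepWithin V s ∘ stepWithin V t)^[4] u = u := by
  obtain ⟨⟨e1, e2, e3⟩, ⟨e4, e5, e6⟩, e7⟩ := hexagon_relations (u := u) hs ht hst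
  simp only [Function.iterate_succ, Function.iterate_zero, Function.comp_apply, id]
  by_cases h : V (u * s * t) <;> simp [stepWithin, *]

theorem stepWithin_iterate_four_of_right (hs : s * s = 1) (ht : t * t = 1)
    (hst : s * t * s = t * s * t) (hu : V u) (h1 : V (u * t))
    (h2 : V (u * s * t * s) ↔ V (u * t * s)) (h3 : V (u * s) ↔ ¬ V (u * t * s))
    (h4 : V (u * s * t) ↔ ¬ V (u * t * s)) :
    (stepWithin V s ∘ stepWithin V t)^[4] u = u := by
  obtain ⟨⟨e1, e2, e3⟩, ⟨e4, e5, e6⟩, e7⟩ := hexagon_relations (u := u) hs ht hst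
  simp only [Function.iterate_succ, Function.iterate_zero, Function.comp_apply, id]
  by_cases h : V (u * t * s) <;> simp [stepWithin, *]

end PartialAction

section InitialLetters

variable {n : ℕ}

/-- The letter of `π` in position `j`, as a residue. -/
def letter (π : Perm (Fin n)) (j : Fin n) : ZMod n := ((π j : ℕ) : ZMod n)

/-- The set of the first `k` letters of `π`. -/
def initialLetters (π : Perm (Fin n)) (k : ℕ) : Set (ZMod n) :=
  {x | ∃ j : Fin n, (j : ℕ) < k ∧ letter π j = x}

theorem letter_injective (π : Perm (Fin n)) : Function.Injective (letter π) := by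
  intro i j h
  rw [letter, letter, ZMod.natCast_eq_natCast_iff', Nat.mod_eq_of_lt (π i).2,
    Nat.mod_eq_of_lt (π j).2] at h
  exact π.injective (Fin.ext h)

theorem letter_surjective [NeZero n] (π : Perm (Fin n)) : Function.Surjective (letter π) := by
  intro x
  refine ⟨π.symm ⟨x.val, ZMod.val_lt x⟩, ?_⟩
  simp [letter]

theorem letter_mem_initialLetters {π : Perm (Fin n)} {j : Fin n} {k : ℕ} :
    letter π j ∈ initialLetters π k ↔ (j : ℕ) < k :=
  ⟨fun ⟨_, hi, e⟩ => letter_injective π e ▸ hi, fun h => ⟨j, h, rfl⟩⟩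

theorem initialLetters_zero (π : Perm (Fin n)) : initialLetters π 0 = ∅ := by
  simp [initialLetters]

theorem initialLetters_of_le [NeZero n] (π : Perm (Fin n)) {k : ℕ} (hk : n ≤ k) :
    initialLetters π k = Set.univ := by
  rw [Set.eq_univ_iff_forall, (letter_surjective π).forall]
  exact fun j => letter_mem_initialLetters.2 (j.2.trans_le hk)

theorem initialLetters_succ (π : Perm (Fin n)) {k : ℕ} (hk : k < n) :
    initialLetters π (k + 1) = insert (letter π ⟨k, hk⟩) (initialLetters π k) := by
  ext x
  simp only [initialLetters, Set.mem_ofPred_eq, Set.mem_insert_iff]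
  constructor
  · rintro ⟨j, hj, rfl⟩
    rcases Nat.lt_succ_iff_lt_or_eq.1 hj with hj | hj
    · exact Or.inr ⟨j, hj, rfl⟩
    · exact Or.inl (congrArg _ (Fin.ext hj))
  · rintro (rfl | ⟨j, hj, rfl⟩)
    · exact ⟨⟨k, hk⟩, Nat.lt_succ_self k, rfl⟩
    · exact ⟨j, by omega, rfl⟩

theorem initialLetters_congr_of_lt {π τ : Perm (Fin n)} {k : ℕ}
    (h : ∀ j : Fin n, (j : ℕ) < k → τ j = π j) : initialLetters τ k = initialLetters π k := by
  ext x
  simp only [initialLetters, letter, Set.mem_ofPred_eq]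
  exact exists_congr fun j => and_congr_right fun hj => by rw [h j hj]

theorem initialLetters_congr_of_le [NeZero n] {π τ : Perm (Fin n)} {k : ℕ}
    (h : ∀ j : Fin n, k ≤ j → τ j = π j) : initialLetters τ k = initialLetters π k := by
  have key : ∀ {π τ : Perm (Fin n)}, (∀ j : Fin n, k ≤ j → τ j = π j) →
      initialLetters τ k ⊆ initialLetters π k := by
    rintro π τ h _ ⟨j, hj, rfl⟩
    obtain ⟨i, hi⟩ := letter_surjective π (letter τ j)
    rw [← hi, letter_mem_initialLetters]
    by_contra hk
    rw [not_lt] at hk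
    have : letter τ i = letter τ j := by rw [← hi, letter, letter, h i hk]
    rw [letter_injective τ this] at hk
    omega
  exact (key h).antisymm (key fun j hj => (h j hj).symm)

theorem isCyclicIntervalFinset_prefSet_iff_s18 [NeZero n] (π : Perm (Fin n)) (j : Fin n) :
    IsCyclicIntervalFinset (prefSet π j) ↔ IsArcSet (initialLetters π (j + 1)) := by
  have hmem : ∀ x : Fin n,
      x ∈ prefSet π j ↔ ((x : ℕ) : ZMod n) ∈ initialLetters π (j + 1) := by
    intro x
    obtain ⟨i, rfl⟩ := π.surjective x
    change _ ↔ letter π i ∈ _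
    rw [letter_mem_initialLetters]
    simp [prefSet]
  simp only [IsCyclicIntervalFinset, hmem]
  constructor
  · rintro ⟨a, k, h⟩
    refine ⟨a, k, fun x => ?_⟩
    simpa using h ⟨x.val, ZMod.val_lt x⟩
  · rintro ⟨a, k, h⟩
    exact ⟨a.val, k, fun x => by simpa using h x⟩

theorem isArc_iff [NeZero n] (π : Perm (Fin n)) :
    IsArc π ↔ ∀ k, IsArcSet (initialLetters π k) := by
  simp only [IsArc, isCyclicIntervalFinset_prefSet_iff_s18]
  refine ⟨fun h k => ?_, fun h j => h _⟩
  rcases k with _ | k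
  · rw [initialLetters_zero]
    exact .empty
  · rcases lt_or_ge k n with hk | hk
    · exact h ⟨k, hk⟩
    · rw [initialLetters_of_le π (by omega), ← IsArcSet.compl_iff, Set.compl_univ]
      exact .empty

end InitialLetters

section AdjacentSwaps

variable {n : ℕ}

/-- The transposition of the positions `i` and `i + 1`. -/
def adjSwap (i : ℕ) (h : i + 1 < n) : Perm (Fin n) :=
  swap ⟨i, Nat.lt_of_succ_lt h⟩ ⟨i + 1, h⟩

theorem adjSwap_mul_self (i : ℕ) (h : i + 1 < n) : adjSwap i h * adjSwap i h = 1 :=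
  swap_mul_self _ _

theorem adjSwap_apply_of_ne {i : ℕ} (h : i + 1 < n) {j : Fin n} (h1 : (j : ℕ) ≠ i)
    (h2 : (j : ℕ) ≠ i + 1) : adjSwap i h j = j :=
  swap_apply_of_ne_of_ne (fun e => h1 (congrArg Fin.val e)) (fun e => h2 (congrArg Fin.val e))

theorem adjSwap_comm {i j : ℕ} (hi : i + 1 < n) (hj : j + 1 < n) (hij : i + 1 < j) :
    adjSwap i hi * adjSwap j hj = adjSwap j hj * adjSwap i hi := by
  refine (Perm.Disjoint.commute fun k => ?_).eq
  by_cases h : (k : ℕ) = i ∨ (k : ℕ) = i + 1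
  · exact Or.inr (adjSwap_apply_of_ne hj (by omega) (by omega))
  · exact Or.inl (adjSwap_apply_of_ne hi (by omega) (by omega))

theorem adjSwap_braid {i : ℕ} (h : i + 2 < n) :
    adjSwap i (by omega) * adjSwap (i + 1) h * adjSwap i (by omega) =
      adjSwap (i + 1) h * adjSwap i (by omega) * adjSwap (i + 1) h := by
  ext j
  simp only [adjSwap, Perm.mul_apply, swap_apply_def, Fin.ext_iff]
  grind

theorem initialLetters_mul_adjSwap [NeZero n] (π : Perm (Fin n)) {i k : ℕ} (h : i + 1 < n)
    (hk : k ≠ i + 1) : initialLetters (π * adjSwap i h) k = initialLetters π k := by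
  rcases lt_or_ge k (i + 1) with hk' | hk'
  · refine initialLetters_congr_of_lt fun j hj => ?_
    rw [Perm.mul_apply, adjSwap_apply_of_ne h (by omega) (by omega)]
  · refine initialLetters_congr_of_le fun j hj => ?_
    rw [Perm.mul_apply, adjSwap_apply_of_ne h (by omega) (by omega)]

theorem isArc_mul_adjSwap_iff [NeZero n] {π : Perm (Fin n)} (hπ : IsArc π) {i : ℕ}
    (h : i + 1 < n) :
    IsArc (π * adjSwap i h) ↔ IsArcSet (initialLetters (π * adjSwap i h) (i + 1)) := by
  rw [isArc_iff] at hπ ⊢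
  refine ⟨fun h' => h' _, fun h' k => ?_⟩
  rcases eq_or_ne k (i + 1) with rfl | hk
  · exact h'
  · rw [initialLetters_mul_adjSwap π h hk]
    exact hπ k

theorem isArc_mul_adjSwap_mul_adjSwap_iff [NeZero n] {π : Perm (Fin n)} (hπ : IsArc π)
    {i j : ℕ} (hi : i + 1 < n) (hj : j + 1 < n) (hij : i + 1 < j) :
    IsArc (π * adjSwap i hi * adjSwap j hj) ↔
      IsArc (π * adjSwap i hi) ∧ IsArc (π * adjSwap j hj) := by
  have hcomm : π * adjSwap i hi * adjSwap j hj = π * adjSwap j hj * adjSwap i hi := by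
    rw [mul_assoc, adjSwap_comm hi hj hij, mul_assoc]
  have e1 : initialLetters (π * adjSwap i hi * adjSwap j hj) (i + 1) =
      initialLetters (π * adjSwap i hi) (i + 1) :=
    initialLetters_mul_adjSwap _ hj (by omega)
  have e2 : initialLetters (π * adjSwap i hi * adjSwap j hj) (j + 1) =
      initialLetters (π * adjSwap j hj) (j + 1) := by
    rw [hcomm, initialLetters_mul_adjSwap _ hi (by omega)]
  constructor
  · intro h
    rw [isArc_mul_adjSwap_iff hπ, isArc_mul_adjSwap_iff hπ, ← e1, ← e2]
    rw [isArc_iff] at h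
    exact ⟨h _, h _⟩
  · rintro ⟨h1, h2⟩
    rw [isArc_mul_adjSwap_iff h1, e2]
    exact (isArc_iff _).1 h2 _

/-- Rearranging three consecutive letters of an arc permutation. -/
theorem isArc_iff_of_eq_off [NeZero n] {π τ : Perm (Fin n)} (hπ : IsArc π) {i : ℕ}
    (hi : i + 2 < n) (hτ : ∀ j : Fin n, (j : ℕ) < i ∨ i + 2 < j → τ j = π j) :
    IsArc τ ↔
      IsArcSet (insert (letter τ ⟨i, by omega⟩) (initialLetters π i)) ∧
      IsArcSet (insert (letter τ ⟨i + 1, by omega⟩)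
        (insert (letter τ ⟨i, by omega⟩) (initialLetters π i))) := by
  have e0 : ∀ k ≤ i, initialLetters τ k = initialLetters π k := fun k hk =>
    initialLetters_congr_of_lt fun j hj => hτ j (Or.inl (by omega))
  have e3 : ∀ k, i + 3 ≤ k → initialLetters τ k = initialLetters π k := fun k hk =>
    initialLetters_congr_of_le fun j hj => hτ j (Or.inr (by omega))
  rw [← e0 i le_rfl, ← initialLetters_succ, ← initialLetters_succ, isArc_iff]
  rw [isArc_iff] at hπ
  refine ⟨fun h => ⟨h _, h _⟩, fun h k => ?_⟩
  have hk : k ≤ i ∨ k = i + 1 ∨ k = i + 1 + 1 ∨ i + 3 ≤ k := by omega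
  rcases hk with hk | rfl | rfl | hk
  · exact e0 k hk ▸ hπ k
  · exact h.1
  · exact h.2
  · exact e3 k hk ▸ hπ k

/-- The arrangements of three consecutive letters `x`, `y`, `z` of an arc permutation, in terms of
the set `I` of the letters before them. -/
theorem isArc_arrangements [NeZero n] {π : Perm (Fin n)} (hπ : IsArc π) {i : ℕ} (hi : i + 2 < n)
    {I : Set (ZMod n)} {x y z : ZMod n} {s t : Perm (Fin n)} (hI : I = initialLetters π i)
    (hx : x = letter π ⟨i, by omega⟩) (hy : y = letter π ⟨i + 1, by omega⟩)
    (hz : z = letter π ⟨i + 2, hi⟩) (hs : s = adjSwap i (by omega))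
    (ht : t = adjSwap (i + 1) hi) :
    (IsArc (π * s) ↔ IsArcSet (insert y I) ∧ IsArcSet (insert y (insert x I))) ∧
    (IsArc (π * s * t) ↔ IsArcSet (insert y I) ∧ IsArcSet (insert z (insert y I))) ∧
    (IsArc (π * s * t * s) ↔ IsArcSet (insert z I) ∧ IsArcSet (insert z (insert y I))) ∧
    (IsArc (π * t * s) ↔ IsArcSet (insert z I) ∧ IsArcSet (insert z (insert x I))) ∧
    (IsArc (π * t) ↔ IsArcSet (insert x I) ∧ IsArcSet (insert z (insert x I))) := by
  have hs' : ∀ j : Fin n, (j : ℕ) < i ∨ i + 2 < j → s j = j := fun j hj =>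
    hs ▸ adjSwap_apply_of_ne _ (by omega) (by omega)
  have ht' : ∀ j : Fin n, (j : ℕ) < i ∨ i + 2 < j → t j = j := fun j hj =>
    ht ▸ adjSwap_apply_of_ne _ (by omega) (by omega)
  have s0 : s ⟨i, by omega⟩ = ⟨i + 1, by omega⟩ := by simp [hs, adjSwap]
  have s1 : s ⟨i + 1, by omega⟩ = ⟨i, by omega⟩ := by simp [hs, adjSwap]
  have s2 : s ⟨i + 2, hi⟩ = ⟨i + 2, hi⟩ := hs ▸ adjSwap_apply_of_ne _ (by simp) (by simp)
  have t0 : t ⟨i, by omega⟩ = ⟨i, by omega⟩ :=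
    ht ▸ adjSwap_apply_of_ne _ (by simp) (by simp only [ne_eq]; omega)
  have t1 : t ⟨i + 1, by omega⟩ = ⟨i + 2, hi⟩ := by simp [ht, adjSwap]
  have t2 : t ⟨i + 2, hi⟩ = ⟨i + 1, by omega⟩ := by simp [ht, adjSwap]
  rw [Set.insert_comm y x, Set.insert_comm z x]
  refine ⟨?_, ?_, ?_, ?_, ?_⟩
  · rw [isArc_iff_of_eq_off hπ hi (by simp +contextual [hs'])]
    simp only [letter, Perm.mul_apply, s0, s1, hI, hx, hy]
  · rw [isArc_iff_of_eq_off hπ hi (by simp +contextual [hs', ht'])]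
    simp only [letter, Perm.mul_apply, s0, t0, t1, s2, hI, hy, hz]
  · rw [isArc_iff_of_eq_off hπ hi (by simp +contextual [hs', ht']), Set.insert_comm z y]
    simp only [letter, Perm.mul_apply, s0, s1, s2, t0, t1, hI, hy, hz]
  · rw [isArc_iff_of_eq_off hπ hi (by simp +contextual [hs', ht'])]
    simp only [letter, Perm.mul_apply, s0, s1, t0, t1, hI, hx, hz]
  · rw [isArc_iff_of_eq_off hπ hi (by simp +contextual [ht']), Set.insert_comm x z]
    simp only [letter, Perm.mul_apply, t0, t1, hI, hx, hz]

theorem stepWithin_isArc_iterate_three {π : Perm (Fin n)} (hπ : IsArc π) {i : ℕ} (hi0 : 0 < i)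
    (hi : i + 3 < n) :
    (stepWithin IsArc (adjSwap i (by omega)) ∘
      stepWithin IsArc (adjSwap (i + 1) (by omega)))^[3] π = π := by
  have : NeZero n := ⟨by omega⟩
  have hπ' := (isArc_iff π).1 hπ
  have e1 := initialLetters_succ π (k := i) (by omega)
  have e2 := initialLetters_succ π (k := i + 1) (by omega)
  have e3 := initialLetters_succ π (k := i + 2) (by omega)
  obtain ⟨a1, a2, a3, a4, a5⟩ := isArc_arrangements hπ (i := i) (by omega) rfl rfl rfl rfl rfl rfl
  have key := insertion_orders_of_nonempty (hπ' i)
    ⟨_, (letter_mem_initialLetters (j := ⟨0, by omega⟩)).2 hi0⟩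
    ⟨letter π ⟨i + 3, hi⟩, by
      rw [← e1, ← e2, ← e3, Set.mem_compl_iff, letter_mem_initialLetters]; simp⟩
    (by simp [letter_mem_initialLetters]) (by simp [letter_mem_initialLetters])
    (by simp [letter_mem_initialLetters])
    (by simp [(letter_injective π).eq_iff]) (by simp [(letter_injective π).eq_iff])
    (by simp [(letter_injective π).eq_iff])
    (e1 ▸ hπ' _) (by rw [← e1, ← e2]; exact hπ' _) (by rw [← e1, ← e2, ← e3]; exact hπ' _)
  have h1 : IsArcSet (insert (letter π ⟨i, by omega⟩) (initialLetters π i)) := e1 ▸ hπ' _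
  have h2 : IsArcSet (insert (letter π ⟨i + 1, by omega⟩)
      (insert (letter π ⟨i, by omega⟩) (initialLetters π i))) := by
    rw [← e1, ← e2]; exact hπ' _
  refine stepWithin_iterate_three (adjSwap_mul_self _ _) (adjSwap_mul_self _ _)
    (adjSwap_braid (by omega)) hπ ?_
  rw [a1, a2, a3, a4, a5]
  grind only

theorem stepWithin_isArc_iterate_four_zero (hn : 4 ≤ n) {π : Perm (Fin n)} (hπ : IsArc π) :
    (stepWithin IsArc (adjSwap 0 (by omega)) ∘
      stepWithin IsArc (adjSwap 1 (by omega)))^[4] π = π := by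
  have : NeZero n := ⟨by omega⟩
  have hπ' := (isArc_iff π).1 hπ
  have e1 := initialLetters_succ π (k := 0) (by omega)
  have e2 := initialLetters_succ π (k := 1) (by omega)
  have e3 := initialLetters_succ π (k := 2) (by omega)
  obtain ⟨a1, a2, a3, a4, a5⟩ := isArc_arrangements hπ (i := 0) (by omega) rfl rfl rfl rfl rfl rfl
  simp only [initialLetters_zero, insert_empty_eq, zero_add, IsArcSet.singleton, true_and]
    at e1 e2 e3 a1 a2 a3 a4 a5
  have h2 := hπ' 2
  have h3 := hπ' 3
  rw [e3, e2, e1] at h3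
  rw [e2, e1] at h2
  have key := IsArcSet.pair_iff_not_pair hn (by simp [(letter_injective π).eq_iff])
    (by simp [(letter_injective π).eq_iff]) (by simp [(letter_injective π).eq_iff]) h2 h3
  apply stepWithin_iterate_four_of_left (adjSwap_mul_self _ _) (adjSwap_mul_self _ _)
    (adjSwap_braid (by omega)) hπ <;> simp only [zero_add, a1, a2, a3, a4, a5] <;> tauto

theorem stepWithin_isArc_iterate_four_last {i : ℕ} (hi0 : 0 < i) (hi : i + 3 = n)
    {π : Perm (Fin n)} (hπ : IsArc π) :
    (stepWithin IsArc (adjSwap i (by omega)) ∘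
      stepWithin IsArc (adjSwap (i + 1) (by omega)))^[4] π = π := by
  have : NeZero n := ⟨by omega⟩
  have hπ' := (isArc_iff π).1 hπ
  have e1 := initialLetters_succ π (k := i) (by omega)
  have e2 := initialLetters_succ π (k := i + 1) (by omega)
  have e3 := initialLetters_succ π (k := i + 2) (by omega)
  obtain ⟨a1, a2, a3, a4, a5⟩ := isArc_arrangements hπ (i := i) (by omega) rfl rfl rfl rfl rfl rfl
  have huniv := initialLetters_of_le π hi.ge
  rw [e3, e2, e1] at huniv
  have h1 := hπ' (i + 1)
  rw [e1] at h1
  have hxI : letter π ⟨i, by omega⟩ ∉ initialLetters π i := by simp [letter_mem_initialLetters]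
  have hyI : letter π ⟨i + 1, by omega⟩ ∉ initialLetters π i := by
    simp [letter_mem_initialLetters]
  have hzI : letter π ⟨i + 2, by omega⟩ ∉ initialLetters π i := by
    simp [letter_mem_initialLetters]
  have hxy : letter π ⟨i, by omega⟩ ≠ letter π ⟨i + 1, by omega⟩ := by
    simp [(letter_injective π).eq_iff]
  have hxz : letter π ⟨i, by omega⟩ ≠ letter π ⟨i + 2, by omega⟩ := by
    simp [(letter_injective π).eq_iff]
  have hyz : letter π ⟨i + 1, by omega⟩ ≠ letter π ⟨i + 2, by omega⟩ := by
    simp [(letter_injective π).eq_iff]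
  have key := insertion_orders_of_univ (by omega) (hπ' i) huniv hxI hyI hzI hxy hxz hyz h1
  generalize letter π ⟨i, _⟩ = x at *
  generalize letter π ⟨i + 1, _⟩ = y at *
  generalize letter π ⟨i + 2, _⟩ = z at *
  have pair : ∀ {a b c : ZMod n}, insert c (insert b (insert a (initialLetters π i))) = Set.univ →
      c ∉ insert b (insert a (initialLetters π i)) →
      IsArcSet (insert b (insert a (initialLetters π i))) := by
    intro a b c hu hc
    have hc' : (insert b (insert a (initialLetters π i)))ᶜ = {c} :=
      Set.eq_singleton_iff_unique_mem.2 ⟨hc, fun u hu' =>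
        (hu.ge (Set.mem_univ u)).resolve_right hu'⟩
    rw [← IsArcSet.compl_iff, hc']
    exact .singleton c
  have hyx := pair huniv (by simp [hzI, hyz.symm, hxz.symm])
  have hzx := pair (a := x) (b := z) (c := y) (by rw [Set.insert_comm, huniv])
    (by simp [hyI, hyz, hxy.symm])
  have hzy := pair (a := y) (b := z) (c := x)
    (by rw [Set.insert_comm, Set.insert_comm x y, huniv]) (by simp [hxI, hxz, hxy])
  apply stepWithin_iterate_four_of_right (adjSwap_mul_self _ _) (adjSwap_mul_self _ _)
    (adjSwap_braid (by omega)) hπ <;> simp only [a1, a2, a3, a4, a5] <;> grind only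

theorem rho_val {i : ℕ} (h : i + 1 < n) (π : {π : Perm (Fin n) // IsArc π}) :
    (rho i π).val = stepWithin IsArc (adjSwap i h) π.val := by
  simp only [rho, stepWithin, adjSwap, dif_pos h]
  split_ifs <;> simp [*]

theorem rho_rho (i : ℕ) (π : {π : Perm (Fin n) // IsArc π}) : rho i (rho i π) = π := by
  by_cases h : i + 1 < n
  · apply Subtype.ext
    have e : π.val * adjSwap i h * adjSwap i h = π.val := by
      rw [mul_assoc, adjSwap_mul_self, mul_one]
    rw [rho_val h, rho_val h]
    by_cases h' : IsArc (π.val * adjSwap i h) <;> simp [stepWithin, h', e, π.2]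
  · simp [rho, h]

theorem rho_comm {i j : ℕ} (hj : j + 1 < n) (hij : i + 1 < j)
    (π : {π : Perm (Fin n) // IsArc π}) : rho i (rho j π) = rho j (rho i π) := by
  have : NeZero n := ⟨by omega⟩
  have hi : i + 1 < n := by omega
  apply Subtype.ext
  rw [rho_val hi, rho_val hj, rho_val hj, rho_val hi]
  exact stepWithin_comm (adjSwap_comm hi hj hij) (isArc_mul_adjSwap_mul_adjSwap_iff π.2 hi hj hij)

theorem rho_comp_iterate_val {i j : ℕ} (hi : i + 1 < n) (hj : j + 1 < n) (k : ℕ)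
    (π : {π : Perm (Fin n) // IsArc π}) :
    ((rho i ∘ rho j)^[k] π).val =
      (stepWithin IsArc (adjSwap i hi) ∘ stepWithin IsArc (adjSwap j hj))^[k] π.val :=
  Function.Semiconj.iterate_right (f := Subtype.val)
    (fun σ => by simp only [Function.comp_apply, rho_val hi, rho_val hj]) k π

end AdjacentSwaps

/-- The maps `ρ_0, …, ρ_{n-2}` satisfy the Coxeter relations of the affine Weyl
group `C̃_{n-2}`: involutions, commutation for `|i-j| > 1`, braid relations of
order 3 for `1 ≤ i ≤ n-4`, and of order 4 for `i = 0` and `i = n-3` (when these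
indices are all in range, i.e. `n ≥ 4`). -/
theorem stmt18 (n : ℕ) (hn : 2 ≤ n) :
    (∀ i ≤ n - 2, ∀ π : {π : Equiv.Perm (Fin n) // IsArc π}, rho i (rho i π) = π) ∧
    (∀ i j, i ≤ n - 2 → j ≤ n - 2 → (i + 1 < j ∨ j + 1 < i) →
      ∀ π : {π : Equiv.Perm (Fin n) // IsArc π}, rho i (rho j π) = rho j (rho i π)) ∧
    (∀ i, 1 ≤ i → i ≤ n - 4 →
      ∀ π : {π : Equiv.Perm (Fin n) // IsArc π}, (rho i ∘ rho (i + 1))^[3] π = π) ∧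
    (4 ≤ n → ∀ π : {π : Equiv.Perm (Fin n) // IsArc π},
      (rho 0 ∘ rho 1)^[4] π = π ∧ (rho (n - 3) ∘ rho (n - 2))^[4] π = π) := by
  refine ⟨fun i _ => rho_rho i, fun i j hi hj hij π => ?_, fun i hi0 hi π => ?_,
    fun h4 π => ⟨?_, ?_⟩⟩
  · rcases hij with h | h
    · exact rho_comm (by omega) h π
    · exact (rho_comm (by omega) h π).symm
  · apply Subtype.ext
    rw [rho_comp_iterate_val (by omega) (by omega)]
    exact stepWithin_isArc_iterate_three π.2 hi0 (by omega)
  · apply Subtype.ext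
    rw [rho_comp_iterate_val (by omega) (by omega)]
    exact stepWithin_isArc_iterate_four_zero h4 π.2
  · obtain ⟨i, rfl⟩ := Nat.exists_eq_add_of_le' (by omega : 3 ≤ n)
    apply Subtype.ext
    rw [show i + 3 - 3 = i by omega, show i + 3 - 2 = i + 1 by omega,
      rho_comp_iterate_val (by omega) (by omega)]
    exact stepWithin_isArc_iterate_four_last (by omega) rfl π.2
end

section
/- For every n ≥ 2, a permutation π ∈ S_n is a shuffle of two increasing sequences — i.e., there exists 0 ≤ k ≤ n such that π⁻¹(1) < π⁻¹(2) < … < π⁻¹(k) and π⁻¹(k+1) < π⁻¹(k+2) < … < π⁻¹(n) — if and only if π avoids all three patterns 321, 2143, 2413; moreover |S_n(321, 2143, 2413)| = 2^n − n. -/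
/-- The pattern 321. -/
noncomputable def p321 : Equiv.Perm (Fin 3) := mkPerm ![2, 1, 0] (by decide)

/-- `π` is a shuffle of two increasing sequences: for some `0 ≤ k ≤ n`, the
positions of the values `1,…,k` are increasing and the positions of the values
`k+1,…,n` are increasing (values 0-indexed). -/
def IsShuffle {n : ℕ} (π : Equiv.Perm (Fin n)) : Prop :=
  ∃ k ≤ n,
    (∀ a b : Fin n, (a : ℕ) < (b : ℕ) → (b : ℕ) < k → π⁻¹ a < π⁻¹ b) ∧
    (∀ a b : Fin n, k ≤ (a : ℕ) → (a : ℕ) < (b : ℕ) → π⁻¹ a < π⁻¹ b)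

theorem contains_p321_iff {n : ℕ} (π : Equiv.Perm (Fin n)) :
    Contains π p321 ↔ ∃ a b c, a < b ∧ b < c ∧ π c < π b ∧ π b < π a := by
  constructor
  · rintro ⟨f, hf, h⟩
    exact ⟨f 0, f 1, f 2, hf (by decide), hf (by decide),
      (h 2 1).2 (by simp [p321, mkPerm]), (h 1 0).2 (by simp [p321, mkPerm])⟩
  · rintro ⟨a, b, c, hab, hbc, h1, h2⟩
    refine ⟨![a, b, c], by simp [Fin.strictMono_iff_lt_succ, Fin.forall_fin_succ, *], ?_⟩
    simp only [Fin.forall_fin_succ, p321, mkPerm]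
    simp
    grind

theorem contains_p2143_iff {n : ℕ} (π : Equiv.Perm (Fin n)) :
    Contains π p2143 ↔
      ∃ a b c d, a < b ∧ b < c ∧ c < d ∧ π b < π a ∧ π a < π d ∧ π d < π c := by
  constructor
  · rintro ⟨f, hf, h⟩
    exact ⟨f 0, f 1, f 2, f 3, hf (by decide), hf (by decide), hf (by decide),
      (h 1 0).2 (by simp [p2143, mkPerm]), (h 0 3).2 (by simp [p2143, mkPerm]),
      (h 3 2).2 (by simp [p2143, mkPerm])⟩
  · rintro ⟨a, b, c, d, hab, hbc, hcd, h1, h2, h3⟩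
    refine ⟨![a, b, c, d], by simp [Fin.strictMono_iff_lt_succ, Fin.forall_fin_succ, *], ?_⟩
    simp only [Fin.forall_fin_succ, p2143, mkPerm]
    simp
    grind

theorem contains_p2413_iff {n : ℕ} (π : Equiv.Perm (Fin n)) :
    Contains π p2413 ↔
      ∃ a b c d, a < b ∧ b < c ∧ c < d ∧ π c < π a ∧ π a < π d ∧ π d < π b := by
  constructor
  · rintro ⟨f, hf, h⟩
    exact ⟨f 0, f 1, f 2, f 3, hf (by decide), hf (by decide), hf (by decide),
      (h 2 0).2 (by simp [p2413, mkPerm]), (h 0 3).2 (by simp [p2413, mkPerm]),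
      (h 3 1).2 (by simp [p2413, mkPerm])⟩
  · rintro ⟨a, b, c, d, hab, hbc, hcd, h1, h2, h3⟩
    refine ⟨![a, b, c, d], by simp [Fin.strictMono_iff_lt_succ, Fin.forall_fin_succ, *], ?_⟩
    simp only [Fin.forall_fin_succ, p2413, mkPerm]
    simp
    grind

/-- A shuffle is a permutation all of whose inversions straddle a common threshold. -/
theorem isShuffle_iff_inversions {n : ℕ} (π : Equiv.Perm (Fin n)) :
    IsShuffle π ↔ ∃ k ≤ n, ∀ i j, i < j → π j < π i → (π j : ℕ) < k ∧ k ≤ (π i : ℕ) := by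
  refine exists_congr fun k => and_congr_right fun _ => ⟨?_, fun h => ⟨?_, ?_⟩⟩
  · rintro ⟨h1, h2⟩ i j hij hlt
    have h1 := h1 (π j) (π i) hlt
    have h2 := fun hk => h2 (π j) (π i) hk hlt
    simp only [Equiv.Perm.coe_inv, Equiv.symm_apply_apply] at h1 h2
    grind
  all_goals
    intro a b h1 h2
    by_contra hc
    have hne : π⁻¹ a ≠ π⁻¹ b := π⁻¹.injective.ne (by grind)
    have := h (π⁻¹ b) (π⁻¹ a) (lt_of_le_of_ne (not_lt.1 hc) hne.symm)
    simp only [Equiv.Perm.coe_inv, Equiv.apply_symm_apply] at this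
    grind

theorem isShuffle_iff_avoids {n : ℕ} (π : Equiv.Perm (Fin n)) :
    IsShuffle π ↔ Avoids π p321 ∧ Avoids π p2143 ∧ Avoids π p2413 := by
  simp only [Avoids, contains_p321_iff, contains_p2143_iff, contains_p2413_iff,
    isShuffle_iff_inversions]
  constructor
  · rintro ⟨k, -, h⟩
    refine ⟨?_, ?_, ?_⟩
    · rintro ⟨a, b, c, hab, hbc, h1, h2⟩
      grind [h a b hab h2, h b c hbc h1]
    · rintro ⟨a, b, c, d, hab, hbc, hcd, h1, h2, h3⟩
      grind [h a b hab h1, h c d hcd h3]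
    · rintro ⟨a, b, c, d, hab, hbc, hcd, h1, h2, h3⟩
      grind [h a c (hab.trans hbc) h1, h b d (hbc.trans hcd) h3]
  · rintro ⟨h321, h2143, h2413⟩
    have straddle : ∀ i j i' j', i < j → π j < π i → i' < j' → π j' < π i' → π j' < π i := by
      intro i j i' j' hij h hij' h'
      by_contra! hle
      rcases hle.eq_or_lt with heq | hlt
      · obtain rfl := π.injective heq
        exact h321 ⟨_, _, _, hij', hij, h, h'⟩
      have h1 : j < j' := by
        by_contra! hc
        rcases hc.eq_or_lt with rfl | hc
        · order
        exact h321 ⟨_, _, _, hij', hc, h.trans hlt, h'⟩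
      have h2 : i < i' := by
        by_contra! hc
        rcases hc.eq_or_lt with rfl | hc
        · order
        exact h321 ⟨_, _, _, hc, hij, h, hlt.trans h'⟩
      rcases lt_trichotomy j i' with hc | rfl | hc
      · exact h2143 ⟨_, _, _, _, hij, hc, hij', h, hlt, h'⟩
      · order
      · exact h2413 ⟨_, _, _, _, h2, hc, h1, h, hlt, h'⟩
    classical
    refine ⟨Finset.univ.sup fun j => if ∃ i < j, π j < π i then (π j : ℕ) + 1 else 0, ?_, ?_⟩
    · refine Finset.sup_le fun j _ => ?_
      split_ifs <;> omega
    · refine fun i j hij h => ⟨?_, ?_⟩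
      · refine Nat.lt_of_succ_le (le_trans ?_ (Finset.le_sup (Finset.mem_univ j)))
        rw [if_pos ⟨i, hij, h⟩]
      · refine Finset.sup_le fun j' _ => ?_
        split_ifs with hj'
        · obtain ⟨i', hij', h'⟩ := hj'
          exact straddle i j i' j' hij h hij' h'
        · omega

/-- The colouring of `Fin n` which is `false` exactly on the first `k` elements. -/
def thresholdColouring (n k : ℕ) (i : Fin n) : Bool := decide (k ≤ (i : ℕ))

theorem monotone_thresholdColouring (n k : ℕ) : Monotone (thresholdColouring n k) := by
  intro i j hij
  simp only [thresholdColouring, Bool.le_iff_imp, decide_eq_true_eq]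
  exact fun h => h.trans hij

theorem Monotone.exists_eq_thresholdColouring {n : ℕ} {f : Fin n → Bool} (hf : Monotone f) :
    ∃ k ≤ n, f = thresholdColouring n k := by
  classical
  have hex : ∃ k, ∀ i : Fin n, k ≤ (i : ℕ) → f i = true := ⟨n, fun i hi => by omega⟩
  refine ⟨Nat.find hex, Nat.find_min' hex fun i hi => by omega, funext fun i => ?_⟩
  by_cases hi : Nat.find hex ≤ (i : ℕ)
  · simp [thresholdColouring, hi, Nat.find_spec hex i hi]
  · have hfi : f i ≠ true := fun h => hi <| Nat.find_min' hex fun j hj =>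
      Bool.le_iff_imp.1 (hf (Fin.le_def.2 hj)) h
    simp [thresholdColouring, hi, hfi]

theorem thresholdColouring_injective {n k l : ℕ} (hk : k ≤ n) (hl : l ≤ n)
    (h : thresholdColouring n k = thresholdColouring n l) : k = l := by
  by_contra hne
  have hlt : min k l < n := by omega
  have := congrFun h ⟨min k l, hlt⟩
  simp only [thresholdColouring, decide_eq_decide] at this
  omega

open Classical in
theorem card_monotone_bool (n : ℕ) :
    (Finset.univ.filter fun f : Fin n → Bool => Monotone f).card = n + 1 := by
  have himage : (Finset.univ.filter fun f : Fin n → Bool => Monotone f) =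
      (Finset.range (n + 1)).image (thresholdColouring n) := by
    ext f
    simp only [Finset.mem_filter, Finset.mem_univ, true_and, Finset.mem_image, Finset.mem_range,
      Nat.lt_succ_iff]
    constructor
    · intro hf
      obtain ⟨k, hk, rfl⟩ := hf.exists_eq_thresholdColouring
      exact ⟨k, hk, rfl⟩
    · rintro ⟨k, -, rfl⟩
      exact monotone_thresholdColouring n k
  rw [himage, Finset.card_image_of_injOn, Finset.card_range]
  intro k hk l hl h
  simp only [Finset.coe_range, Set.mem_Iio, Nat.lt_succ_iff] at hk hl
  exact thresholdColouring_injective hk hl h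

/-- The shuffles are the inverses of the stable sorting permutations of two-colourings. -/
theorem isShuffle_iff_exists_sort {n : ℕ} (π : Equiv.Perm (Fin n)) :
    IsShuffle π ↔ ∃ f : Fin n → Bool, Tuple.sort f = π⁻¹ := by
  constructor
  · rintro ⟨k, -, h1, h2⟩
    refine ⟨thresholdColouring n k ∘ π, (Tuple.eq_sort_iff.2 ⟨?_, fun i j hij h => ?_⟩).symm⟩
    · convert monotone_thresholdColouring n k using 1
      ext i
      simp
    · simp only [Function.comp_apply, Equiv.Perm.coe_inv, Equiv.apply_symm_apply, thresholdColouring,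
        decide_eq_decide] at h
      by_cases hj : (j : ℕ) < k
      · exact h1 i j hij hj
      · exact h2 i j (by omega) hij
  · rintro ⟨f, hf⟩
    obtain ⟨hmono, hlt⟩ := Tuple.eq_sort_iff.1 hf.symm
    obtain ⟨k, hk, hfk⟩ := hmono.exists_eq_thresholdColouring
    have hcol (i : Fin n) : f (π⁻¹ i) = decide (k ≤ (i : ℕ)) := congrFun hfk i
    refine ⟨k, hk, fun a b hab hb => hlt a b hab ?_, fun a b ha hab => hlt a b hab ?_⟩ <;>
    · rw [hcol, hcol, decide_eq_decide]
      omega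

theorem sort_eq_one_of_sort_eq {n : ℕ} {f g : Fin n → Bool} (h : Tuple.sort f = Tuple.sort g)
    (hne : f ≠ g) : Tuple.sort f = 1 := by
  obtain ⟨hfm, hf⟩ := Tuple.eq_sort_iff.1 (Eq.refl (Tuple.sort f))
  obtain ⟨hgm, hg⟩ := Tuple.eq_sort_iff.1 h
  set σ := Tuple.sort f
  obtain ⟨k, hk, hfk⟩ := hfm.exists_eq_thresholdColouring
  obtain ⟨l, hl, hgl⟩ := hgm.exists_eq_thresholdColouring
  have hkl : k ≠ l := by
    rintro rfl
    exact hne (σ.surjective.injective_comp_right (hfk.trans hgl.symm))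
  replace hf (i j : Fin n) (hij : i < j) (hk : k ≤ (i : ℕ) ↔ k ≤ (j : ℕ)) : σ i < σ j := by
    refine hf i j hij ?_
    change (f ∘ σ) i = (f ∘ σ) j
    rw [hfk]
    simp [thresholdColouring, hk]
  replace hg (i j : Fin n) (hij : i < j) (hl : l ≤ (i : ℕ) ↔ l ≤ (j : ℕ)) : σ i < σ j := by
    refine hg i j hij ?_
    change (g ∘ σ) i = (g ∘ σ) j
    rw [hgl]
    simp [thresholdColouring, hl]
  have hσ : StrictMono σ := by
    cases n with
    | zero => exact fun i => i.elim0
    | succ m =>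
      refine Fin.strictMono_iff_lt_succ.2 fun i => ?_
      by_cases hi : (i : ℕ) + 1 = k
      · exact hg _ _ i.castSucc_lt_succ (by simp; omega)
      · exact hf _ _ i.castSucc_lt_succ (by simp; omega)
  exact DFunLike.coe_injective (StrictMono.range_inj hσ strictMono_id |>.1 (by simp))

open Classical in
theorem card_image_sort (n : ℕ) :
    ((Finset.univ : Finset (Fin n → Bool)).image Tuple.sort).card = 2 ^ n - n := by
  have himage : (Finset.univ : Finset (Fin n → Bool)).image Tuple.sort =
      insert 1 ((Finset.univ.filter fun f : Fin n → Bool => ¬ Monotone f).image Tuple.sort) := by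
    ext σ
    simp only [Finset.mem_image, Finset.mem_univ, true_and, Finset.mem_insert, Finset.mem_filter]
    constructor
    · rintro ⟨f, rfl⟩
      by_cases hf : Monotone f
      · exact Or.inl (Tuple.sort_eq_refl_iff_monotone.2 hf)
      · exact Or.inr ⟨f, hf, rfl⟩
    · rintro (rfl | ⟨f, -, rfl⟩)
      · exact ⟨fun _ => false, Tuple.sort_eq_refl_iff_monotone.2 monotone_const⟩
      · exact ⟨f, rfl⟩
  have hinj : Set.InjOn Tuple.sort
      ((Finset.univ.filter fun f : Fin n → Bool => ¬ Monotone f : Finset (Fin n → Bool)) :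
        Set (Fin n → Bool)) := by
    intro f hf g _ h
    by_contra hne
    simp only [Finset.coe_filter, Finset.mem_univ, true_and, Set.mem_ofPred_eq] at hf
    exact hf (Tuple.sort_eq_refl_iff_monotone.1 (sort_eq_one_of_sort_eq h hne))
  rw [himage, Finset.card_insert_of_notMem, Finset.card_image_of_injOn hinj]
  · have hsum := Finset.card_filter_add_card_filter_not (s := Finset.univ)
      (fun f : Fin n → Bool => Monotone f)
    rw [card_monotone_bool, Finset.card_univ, Fintype.card_fun, Fintype.card_bool,
      Fintype.card_fin] at hsum
    omega
  · simp only [Finset.mem_image, Finset.mem_filter, Finset.mem_univ, true_and, not_exists, not_and]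
    exact fun f hf h => hf (Tuple.sort_eq_refl_iff_monotone.1 h)

theorem card_isShuffle (n : ℕ) :
    Nat.card {π : Equiv.Perm (Fin n) // IsShuffle π} = 2 ^ n - n := by
  classical
  rw [← card_image_sort, ← Nat.card_eq_finsetCard]
  refine Nat.card_congr ((Equiv.inv (Equiv.Perm (Fin n))).subtypeEquiv fun π => ?_)
  simp [isShuffle_iff_exists_sort]

/-- A permutation is a shuffle of two increasing sequences iff it avoids the
patterns 321, 2143 and 2413; moreover the number of such permutations is
`2^n - n`. -/
theorem stmt19 (n : ℕ) (hn : 2 ≤ n) :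
    (∀ π : Equiv.Perm (Fin n),
      IsShuffle π ↔ (Avoids π p321 ∧ Avoids π p2143 ∧ Avoids π p2413)) ∧
    Nat.card {π : Equiv.Perm (Fin n) //
        Avoids π p321 ∧ Avoids π p2143 ∧ Avoids π p2413} = 2 ^ n - n := by
  refine ⟨isShuffle_iff_avoids, ?_⟩
  simp only [← isShuffle_iff_avoids]
  exact card_isShuffle n
end
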